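/- For all integers a ≥ 2, b ≥ 1, k ≥ 1, l_1, …, l_k ≥ 1 and any assignment α as in the construction, with n = a + 2b − 1 + Σ_{j=1}^k l_j, there is no smooth Fano n-polytope R with n + k + 4 vertices such that V(P(a, b, k, l, α)) ⊆ V(R). -/

import Mathlib

/-! ## Basic definitions: lattice polytopes, smooth Fano polytopes,
unimodular equivalence, F- and I-equivalence, primitive collections. -/

/-- A point of `ℝ^n` all of whose coordinates are integers. -/
def IsLatticePoint {n : ℕ} (x : Fin n → ℝ) : Prop := ∀ i, ∃ m : ℤ, x i = (m : ℝ)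

/-- The vertex set of a polytope: its extreme points. -/
def vertexSet {n : ℕ} (P : Set (Fin n → ℝ)) : Set (Fin n → ℝ) :=
  Set.extremePoints ℝ P

/-- A lattice `n`-polytope: the convex hull of finitely many lattice points,
of full dimension `n`. -/
def IsLatticePolytope {n : ℕ} (P : Set (Fin n → ℝ)) : Prop :=
  (∃ S : Finset (Fin n → ℝ), (∀ x ∈ S, IsLatticePoint x) ∧
    P = convexHull ℝ (S : Set (Fin n → ℝ))) ∧
  affineSpan ℝ P = ⊤

/-- A face of `P`: an exposed subset of `P`. -/
def IsFaceOf {n : ℕ} (F P : Set (Fin n → ℝ)) : Prop := IsExposed ℝ P F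

/-- A facet of `P`: a face of affine dimension `n - 1`. -/
def IsFacetOf {n : ℕ} (F P : Set (Fin n → ℝ)) : Prop :=
  IsFaceOf F P ∧ Module.finrank ℝ (vectorSpan ℝ F) + 1 = n

/-- A set `S` of points of `ℝ^n` forms a `ℤ`-basis of `ℤ^n`:
it consists of `n` lattice points whose matrix has determinant `±1`. -/
def IsUnimodularBasis {n : ℕ} (S : Set (Fin n → ℝ)) : Prop :=
  ∃ b : Fin n → (Fin n → ℝ), Function.Injective b ∧ Set.range b = S ∧
    (∀ i, IsLatticePoint (b i)) ∧ |(Matrix.of b).det| = 1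

/-- A smooth Fano `n`-polytope: a lattice `n`-polytope with the origin in its
interior such that the vertex set of every facet is a `ℤ`-basis of `ℤ^n`. -/
def IsSmoothFano {n : ℕ} (P : Set (Fin n → ℝ)) : Prop :=
  IsLatticePolytope P ∧ (0 : Fin n → ℝ) ∈ interior P ∧
    ∀ F : Set (Fin n → ℝ), IsFacetOf F P → IsUnimodularBasis (vertexSet P ∩ F)

/-- Two subsets of `ℝ^n` are unimodularly equivalent if an affine map of `ℝ^n`
mapping `ℤ^n` onto `ℤ^n` maps one onto the other. -/
def UnimodularEquiv {n : ℕ} (Q Q' : Set (Fin n → ℝ)) : Prop :=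
  ∃ φ : (Fin n → ℝ) →ᵃ[ℝ] (Fin n → ℝ),
    φ '' {x | IsLatticePoint x} = {x | IsLatticePoint x} ∧ φ '' Q = Q'

/-- One step of an I-sequence: the vertex set of one polytope is obtained from
the vertex set of the other by adding one new lattice point. -/
def IStep {n : ℕ} (P Q : Set (Fin n → ℝ)) : Prop :=
  (∃ w : Fin n → ℝ, IsLatticePoint w ∧ w ∉ vertexSet P ∧
    vertexSet Q = vertexSet P ∪ {w}) ∨
  (∃ w : Fin n → ℝ, IsLatticePoint w ∧ w ∉ vertexSet Q ∧
    vertexSet P = vertexSet Q ∪ {w})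

/-- I-equivalence of smooth Fano `n`-polytopes. -/
def IEquiv {n : ℕ} (P Q : Set (Fin n → ℝ)) : Prop :=
  ∃ (k : ℕ) (c : Fin (k + 1) → Set (Fin n → ℝ)),
    (∀ i, IsSmoothFano (c i)) ∧
    UnimodularEquiv P (c 0) ∧ UnimodularEquiv Q (c (Fin.last k)) ∧
    ∀ i : Fin k, IStep (c i.castSucc) (c i.succ)

/-- `Q` is the stellar subdivision of `P` at the new vertex `w`: `w` is the sum
of the vertices of a proper face `F` of `P`, and the facets of `Q` containing
`w` are exactly the sets `conv({w} ∪ (V(F') \ {v}))` for `F'` a facet of `P`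
containing `F` and `v` a vertex of `F`. -/
def IsStellarSubdivisionAt {n : ℕ} (P Q : Set (Fin n → ℝ)) (w : Fin n → ℝ) : Prop :=
  ∃ F : Set (Fin n → ℝ), IsFaceOf F P ∧ F.Nonempty ∧ F ≠ P ∧
    w = ∑ᶠ v ∈ vertexSet P ∩ F, v ∧
    {G : Set (Fin n → ℝ) | IsFacetOf G Q ∧ w ∈ G} =
      {G : Set (Fin n → ℝ) | ∃ F' v, IsFacetOf F' P ∧ F ⊆ F' ∧
        v ∈ vertexSet P ∩ F ∧
        G = convexHull ℝ (insert w ((vertexSet P ∩ F') \ {v}))}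

/-- One step of an F-sequence: an I-step which moreover is a stellar
subdivision (or its inverse). -/
def FStep {n : ℕ} (P Q : Set (Fin n → ℝ)) : Prop :=
  (∃ w : Fin n → ℝ, IsLatticePoint w ∧ w ∉ vertexSet P ∧
    vertexSet Q = vertexSet P ∪ {w} ∧ IsStellarSubdivisionAt P Q w) ∨
  (∃ w : Fin n → ℝ, IsLatticePoint w ∧ w ∉ vertexSet Q ∧
    vertexSet P = vertexSet Q ∪ {w} ∧ IsStellarSubdivisionAt Q P w)

/-- F-equivalence of smooth Fano `n`-polytopes. -/
def FEquiv {n : ℕ} (P Q : Set (Fin n → ℝ)) : Prop :=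
  ∃ (k : ℕ) (c : Fin (k + 1) → Set (Fin n → ℝ)),
    (∀ i, IsSmoothFano (c i)) ∧
    UnimodularEquiv P (c 0) ∧ UnimodularEquiv Q (c (Fin.last k)) ∧
    ∀ i : Fin k, FStep (c i.castSucc) (c i.succ)

/-- A smooth Fano polytope is F-isolated if every smooth Fano polytope
F-equivalent to it is unimodularly equivalent to it. -/
def FIsolated {n : ℕ} (P : Set (Fin n → ℝ)) : Prop :=
  ∀ Q : Set (Fin n → ℝ), IsSmoothFano Q → FEquiv Q P → UnimodularEquiv Q P

/-- A smooth Fano polytope is I-isolated if every smooth Fano polytope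
I-equivalent to it is unimodularly equivalent to it. -/
def IIsolated {n : ℕ} (P : Set (Fin n → ℝ)) : Prop :=
  ∀ Q : Set (Fin n → ℝ), IsSmoothFano Q → IEquiv Q P → UnimodularEquiv Q P

/-- A primitive collection of a smooth Fano polytope `P`: a nonempty set `A` of
vertices such that `conv(A)` is not a face of `P` but `conv(A \ {x})` is a face
of `P` for every `x ∈ A`. -/
def IsPrimitiveCollection {n : ℕ} (P A : Set (Fin n → ℝ)) : Prop :=
  A.Nonempty ∧ A ⊆ vertexSet P ∧ ¬ IsFaceOf (convexHull ℝ A) P ∧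
    ∀ x ∈ A, IsFaceOf (convexHull ℝ (A \ {x})) P

/-- The standard basis vector `e_i` of `ℝ^n`. -/
def stdBasis {n : ℕ} (i : Fin n) : Fin n → ℝ := fun q => if q = i then 1 else 0

/-- The polytope `T^n = conv{e_1, …, e_n, -(e_1 + ⋯ + e_n)}`,
corresponding to projective `n`-space. -/
def Tpoly (n : ℕ) : Set (Fin n → ℝ) :=
  convexHull ℝ (Set.range (stdBasis (n := n)) ∪ {fun _ => (-1 : ℝ)})

namespace PG

/-! The concrete polytope `P(a, b, k, l, α)` of dimension
`n = a + 2b - 1 + l_1 + ⋯ + l_k`, from the proof of Theorem `general`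
(coordinates are `0`-based: the paper's `e_q` is the standard basis vector at
index `q - 1`). An assignment `α j i : Fin b ⊕ Fin b` names the vertex
`α_{i,j}`, namely `y_{q+1}` for `Sum.inl q` and `u_{q+1}` for `Sum.inr q`. -/

/-- The dimension `n = a + 2b - 1 + ∑ l_j`. -/
def dim (a b k : ℕ) (l : Fin k → ℕ) : ℕ := a + 2 * b - 1 + ∑ j, l j

/-- `v_i = e_i` for `1 ≤ i ≤ a-1`, and
`v_a = -e_1 - ⋯ - e_{a+2b-2} + (a+b-1) e_{a+2b-1}`. -/
def v (a b k : ℕ) (l : Fin k → ℕ) (i : Fin a) : Fin (dim a b k l) → ℝ :=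
  if i.val < a - 1 then fun q => if q.val = i.val then 1 else 0
  else fun q => if q.val = a + 2 * b - 2 then ((a + b - 1 : ℕ) : ℝ)
    else if q.val < a + 2 * b - 2 then -1 else 0

/-- `y_j = e_{a-1+j}` for `1 ≤ j ≤ b-1`, and `y_b = e_{a+b-1} + ⋯ + e_{a+2b-2}`. -/
def y (a b k : ℕ) (l : Fin k → ℕ) (j : Fin b) : Fin (dim a b k l) → ℝ :=
  if j.val < b - 1 then fun q => if q.val = a - 1 + j.val then 1 else 0
  else fun q => if a + b - 2 ≤ q.val ∧ q.val ≤ a + 2 * b - 3 then 1 else 0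

/-- `z = -e_{a+2b-1}`. -/
def z (a b k : ℕ) (l : Fin k → ℕ) : Fin (dim a b k l) → ℝ :=
  fun q => if q.val = a + 2 * b - 2 then -1 else 0

/-- `t = e_{a+2b-1}`. -/
def t (a b k : ℕ) (l : Fin k → ℕ) : Fin (dim a b k l) → ℝ :=
  fun q => if q.val = a + 2 * b - 2 then 1 else 0

/-- `u_j = e_{a+b-1+j}` for `1 ≤ j ≤ b-1`, and
`u_b = e_a + ⋯ + e_{a+b-1} - e_{a+2b-1}`. -/
def u (a b k : ℕ) (l : Fin k → ℕ) (j : Fin b) : Fin (dim a b k l) → ℝ :=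
  if j.val < b - 1 then fun q => if q.val = a + b - 1 + j.val then 1 else 0
  else fun q => if a - 1 ≤ q.val ∧ q.val ≤ a + b - 2 then 1
    else if q.val = a + 2 * b - 2 then -1 else 0

/-- `l_1 + ⋯ + l_{j-1}`. -/
def Lprev (k : ℕ) (l : Fin k → ℕ) (j : Fin k) : ℕ :=
  ∑ j' ∈ Finset.univ.filter (fun j' => j' < j), l j'

/-- The vertex `α_{i,j} ∈ {y_1, …, y_b, u_1, …, u_b}` named by `α j i`. -/
def A (a b k : ℕ) (l : Fin k → ℕ) (α : (j : Fin k) → Fin (l j) → (Fin b ⊕ Fin b))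
    (j : Fin k) (i : Fin (l j)) : Fin (dim a b k l) → ℝ :=
  Sum.elim (y a b k l) (u a b k l) (α j i)

/-- `w_{i,j} = e_{a+2b-1+l_1+⋯+l_{j-1}+i}` for `1 ≤ i ≤ l_j`, and
`w_{l_j+1,j} = -(e_{a+2b-1+l_1+⋯+l_{j-1}+1} + ⋯ + e_{a+2b-1+l_1+⋯+l_j})
+ α_{1,j} + ⋯ + α_{l_j,j}`. -/
def w (a b k : ℕ) (l : Fin k → ℕ) (α : (j : Fin k) → Fin (l j) → (Fin b ⊕ Fin b))
    (j : Fin k) (i : Fin (l j + 1)) : Fin (dim a b k l) → ℝ :=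
  if i.val < l j then
    fun q => if q.val = a + 2 * b - 1 + Lprev k l j + i.val then 1 else 0
  else
    fun q => (∑ i' : Fin (l j), A a b k l α j i' q) -
      (if a + 2 * b - 1 + Lprev k l j ≤ q.val ∧
          q.val < a + 2 * b - 1 + Lprev k l j + l j then 1 else 0)

/-- The polytope `P(a, b, k, l, α)`. -/
def P (a b k : ℕ) (l : Fin k → ℕ)
    (α : (j : Fin k) → Fin (l j) → (Fin b ⊕ Fin b)) :
    Set (Fin (dim a b k l) → ℝ) :=
  convexHull ℝ
    (Set.range (v a b k l) ∪ Set.range (y a b k l) ∪ {z a b k l, t a b k l} ∪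
      Set.range (u a b k l) ∪ ⋃ j, Set.range (w a b k l α j))

end PG


namespace SmoothFano

variable {n : ℕ} {R : Set (Fin n → ℝ)}

/-- A polytope is the convex hull of its vertices. -/
theorem convexHull_vertexSet {S : Set (Fin n → ℝ)} (hS : S.Finite) :
    convexHull ℝ (vertexSet (convexHull ℝ S)) = convexHull ℝ S := by
  have h : closure (convexHull ℝ (vertexSet (convexHull ℝ S))) = _ :=
    closure_convexHull_extremePoints (hS.isCompact_convexHull ℝ) (convex_convexHull ℝ _)
  have hfin : (vertexSet (convexHull ℝ S)).Finite := hS.subset extremePoints_convexHull_subset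
  rwa [(hfin.isClosed_convexHull ℝ).closure_eq] at h

/-- A smooth Fano polytope is the convex hull of its finitely many integral vertices. -/
theorem finite_vertexSet (hR : IsSmoothFano R) :
    (vertexSet R).Finite ∧ (∀ p ∈ vertexSet R, IsLatticePoint p) ∧
      R = convexHull ℝ (vertexSet R) := by
  obtain ⟨⟨⟨S, hS, rfl⟩, -⟩, -, -⟩ := hR
  have hsub : vertexSet (convexHull ℝ (S : Set (Fin n → ℝ))) ⊆ S :=
    extremePoints_convexHull_subset
  exact ⟨S.finite_toSet.subset hsub, fun p hp => hS p (hsub hp),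
    (convexHull_vertexSet S.finite_toSet).symm⟩

theorem le_on_of_le_on_vertexSet (hR : IsSmoothFano R) {f : (Fin n → ℝ) →ₗ[ℝ] ℝ} {c : ℝ}
    (hf : ∀ q ∈ vertexSet R, f q ≤ c) : ∀ q ∈ R, f q ≤ c := by
  have h := (finite_vertexSet hR).2.2
  have hs : convexHull ℝ (vertexSet R) ⊆ {q | f q ≤ c} :=
    convexHull_min hf (convex_halfSpace_le f.isLinear c)
  intro q hq
  rw [h] at hq
  exact hs hq

/-- Every integral point has integral height over a unimodular basis. -/
theorem exists_int_of_isUnimodularBasis {S : Set (Fin n → ℝ)} (hS : IsUnimodularBasis S)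
    {f : (Fin n → ℝ) →ₗ[ℝ] ℝ} (hf : ∀ q ∈ S, f q = 1) {p : Fin n → ℝ} (hp : IsLatticePoint p) :
    ∃ m : ℤ, f p = m := by
  obtain ⟨β, -, hrange, hlat, hdet⟩ := hS
  choose B hB using hlat
  choose P hP using hp
  have hM : Matrix.of β = (Matrix.of B).map (Int.cast : ℤ → ℝ) := by
    ext i j; simp [hB]
  have hd : ((Matrix.of B).det : ℝ) = (Matrix.of β).det := by
    rw [hM]; exact Int.cast_det _
  have hu : IsUnit (Matrix.of B).det := by
    rw [Int.isUnit_iff, ← abs_eq (by norm_num)]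
    rw [← hd, ← Int.cast_abs] at hdet
    exact_mod_cast hdet
  have hc : (Matrix.vecMul (Matrix.vecMul P (Matrix.of B)⁻¹) (Matrix.of B)) = P := by
    rw [Matrix.vecMul_vecMul, Matrix.nonsing_inv_mul _ hu, Matrix.vecMul_one]
  set c := Matrix.vecMul P (Matrix.of B)⁻¹
  refine ⟨∑ i, c i, ?_⟩
  have hsum : p = ∑ i, (c i : ℝ) • β i := by
    ext q
    rw [hP, ← hc]
    simp [Matrix.vecMul, dotProduct, hB]
  rw [hsum, map_sum, Int.cast_sum]
  refine Finset.sum_congr rfl fun i _ => ?_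
  rw [map_smul, hf _ (hrange ▸ Set.mem_range_self i)]
  simp

/-- A set on which only the zero functional vanishes spans. -/
theorem span_eq_top_of_forall_dual {B : Set (Fin n → ℝ)}
    (hspan : ∀ ψ : (Fin n → ℝ) →ₗ[ℝ] ℝ, (∀ q ∈ B, ψ q = 0) → ψ = 0) :
    Submodule.span ℝ B = ⊤ := by
  by_contra h
  obtain ⟨ψ, hψ, hle⟩ := Submodule.exists_le_ker_of_lt_top _ (lt_top_iff_ne_top.2 h)
  exact hψ (hspan ψ fun q hq => hle (Submodule.subset_span hq))

/-- A supporting functional which is `1` on a spanning set of vertices defines a facet. -/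
theorem isUnimodularBasis_of_spanning (hR : IsSmoothFano R) {f : (Fin n → ℝ) →ₗ[ℝ] ℝ}
    (hf : ∀ q ∈ vertexSet R, f q ≤ 1) {B : Set (Fin n → ℝ)} (hne : B.Nonempty)
    (hBV : B ⊆ vertexSet R) (hB : ∀ q ∈ B, f q = 1)
    (hspan : ∀ ψ : (Fin n → ℝ) →ₗ[ℝ] ℝ, (∀ q ∈ B, ψ q = 0) → ψ = 0) :
    IsUnimodularBasis (vertexSet R ∩ {q | q ∈ R ∧ f q = 1}) := by
  obtain ⟨p₀, hp₀⟩ := hne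
  have hle := le_on_of_le_on_vertexSet hR hf
  have hVR : vertexSet R ⊆ R := extremePoints_subset
  have hBF : B ⊆ {q | q ∈ R ∧ f q = 1} := fun q hq => ⟨hVR (hBV hq), hB q hq⟩
  apply hR.2.2
  constructor
  · intro _
    refine ⟨LinearMap.toContinuousLinearMap f, ?_⟩
    ext q
    constructor
    · rintro ⟨hq, hq1⟩
      exact ⟨hq, fun r hr => by simpa [hq1] using hle r hr⟩
    · rintro ⟨hq, hmax⟩
      have h1 := hmax p₀ (hVR (hBV hp₀))
      simp only [LinearMap.coe_toContinuousLinearMap'] at h1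
      rw [hB _ hp₀] at h1
      exact ⟨hq, le_antisymm (hle q hq) h1⟩
  · set F := {q | q ∈ R ∧ f q = 1}
    have hf0 : f ≠ 0 := fun h => by simpa [h] using hB _ hp₀
    have hup : vectorSpan ℝ F ≤ LinearMap.ker f := by
      rw [vectorSpan_def, Submodule.span_le]
      rintro _ ⟨q, hq, r, hr, rfl⟩
      simp [hq.2, hr.2]
    have hker : Module.finrank ℝ (LinearMap.ker f) + 1 = n := by
      have := Module.Dual.finrank_ker_add_one_of_ne_zero (f := f) hf0
      simpa using this
    have htop : (⊤ : Submodule ℝ (Fin n → ℝ)) ≤ vectorSpan ℝ F ⊔ Submodule.span ℝ {p₀} := by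
      rw [← span_eq_top_of_forall_dual hspan, Submodule.span_le]
      intro q hq
      have : q = (q -ᵥ p₀) + p₀ := by simp
      rw [this]
      exact Submodule.add_mem_sup (vsub_mem_vectorSpan ℝ (hBF hq) (hBF hp₀))
        (Submodule.mem_span_singleton_self p₀)
    have h1 := Submodule.finrank_mono htop
    have h2 := Submodule.finrank_add_le_finrank_add_finrank (vectorSpan ℝ F) (Submodule.span ℝ {p₀})
    have h3 := finrank_span_singleton (K := ℝ) (v := p₀)
      (fun h => by simpa [h] using hB _ hp₀)
    have h4 := Submodule.finrank_mono hup
    have h5 : Module.finrank ℝ (⊤ : Submodule ℝ (Fin n → ℝ)) = n := by simp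
    omega

/-- A spanning subset of the vertices of a facet contains all of its vertices. -/
theorem mem_of_spanning (hR : IsSmoothFano R) {f : (Fin n → ℝ) →ₗ[ℝ] ℝ}
    (hf : ∀ q ∈ vertexSet R, f q ≤ 1) {B : Set (Fin n → ℝ)} (hne : B.Nonempty)
    (hBV : B ⊆ vertexSet R) (hB : ∀ q ∈ B, f q = 1)
    (hspan : ∀ ψ : (Fin n → ℝ) →ₗ[ℝ] ℝ, (∀ q ∈ B, ψ q = 0) → ψ = 0)
    {q : Fin n → ℝ} (hq : q ∈ vertexSet R) (hq1 : f q = 1) : q ∈ B := by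
  have hVR : vertexSet R ⊆ R := extremePoints_subset
  obtain ⟨β, hinj, hrange, -, hdet⟩ := isUnimodularBasis_of_spanning hR hf hne hBV hB hspan
  have hli : LinearIndependent ℝ β := by
    have hu : IsUnit (Matrix.of β) := by
      rw [Matrix.isUnit_iff_isUnit_det, isUnit_iff_ne_zero]
      intro h
      simp [h] at hdet
    exact Matrix.linearIndependent_rows_iff_isUnit.2 hu
  obtain ⟨i, rfl⟩ : q ∈ Set.range β := hrange ▸ ⟨hq, hVR hq, hq1⟩
  by_contra hqB
  apply hli.notMem_span_image (s := {i}ᶜ) (x := i) (by simp)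
  have : B ⊆ β '' {i}ᶜ := by
    intro r hr
    obtain ⟨i', rfl⟩ : r ∈ Set.range β := hrange ▸ ⟨hBV hr, hVR (hBV hr), hB r hr⟩
    exact ⟨i', fun h => hqB (by simp only [Set.mem_singleton_iff] at h; rwa [← h]), rfl⟩
  exact Submodule.span_mono this (by rw [span_eq_top_of_forall_dual hspan]; trivial)

/-- The neighbouring facet of the facet `B` opposite to its vertex `p`, where `d` is the
functional dual to `p`. -/
theorem exists_neighbour (hR : IsSmoothFano R) {f d : (Fin n → ℝ) →ₗ[ℝ] ℝ}
    (hf : ∀ q ∈ vertexSet R, f q ≤ 1) {B : Set (Fin n → ℝ)}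
    (hBV : B ⊆ vertexSet R) (hB : ∀ q ∈ B, f q = 1)
    (hspan : ∀ ψ : (Fin n → ℝ) →ₗ[ℝ] ℝ, (∀ q ∈ B, ψ q = 0) → ψ = 0)
    {p : Fin n → ℝ} (hp : p ∈ B) (hdp : d p = 1) (hd : ∀ q ∈ B, q ≠ p → d q = 0)
    {r : Fin n → ℝ} (hr : r ∈ vertexSet R) (hdr : d r < 0) :
    ∃ m : ℕ, 1 ≤ m ∧ ∀ q ∈ vertexSet R, f q - m * d q ≤ 1 := by
  obtain ⟨hfin, hlat, -⟩ := finite_vertexSet hR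
  have hlt : ∀ q ∈ vertexSet R, d q < 0 → f q < 1 := by
    intro q hq hdq
    refine lt_of_le_of_ne (hf q hq) fun h1 => ?_
    have hqB := mem_of_spanning hR hf ⟨p, hp⟩ hBV hB hspan hq h1
    by_cases hqp : q = p
    · rw [hqp, hdp] at hdq; linarith
    · rw [hd q hqB hqp] at hdq; exact lt_irrefl _ hdq
  obtain ⟨q₀, ⟨hq₀, hdq₀⟩, hmin⟩ := Set.exists_min_image {q | q ∈ vertexSet R ∧ d q < 0}
    (fun q => (1 - f q) / (-d q)) (hfin.subset fun q hq => hq.1) ⟨r, hr, hdr⟩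
  set lam := (1 - f q₀) / (-d q₀)
  have hlam0 : 0 < lam := div_pos (by linarith [hlt q₀ hq₀ hdq₀]) (by linarith)
  have hg : ∀ q ∈ vertexSet R, (f - lam • d) q ≤ 1 := by
    intro q hq
    simp only [LinearMap.sub_apply, LinearMap.smul_apply, smul_eq_mul]
    rcases lt_or_ge (d q) 0 with h | h
    · have := (le_div_iff₀ (by linarith)).1 (hmin q ⟨hq, h⟩)
      linarith
    · nlinarith [hf q hq]
  have hgq₀ : (f - lam • d) q₀ = 1 := by
    simp only [LinearMap.sub_apply, LinearMap.smul_apply, smul_eq_mul]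
    have h0 : -d q₀ ≠ 0 := by linarith
    have h1 : lam * -d q₀ = 1 - f q₀ := div_mul_cancel₀ _ h0
    linarith
  have hunim := isUnimodularBasis_of_spanning hR hg (B := insert q₀ (B \ {p}))
    (Set.insert_nonempty _ _)
    (Set.insert_subset hq₀ (Set.sdiff_subset.trans hBV))
    (by
      rintro q (rfl | ⟨hq, hqp⟩)
      · exact hgq₀
      · simp [hB q hq, hd q hq hqp])
    (by
      intro ψ hψ
      have h1 : ψ - ψ p • d = 0 := by
        apply hspan
        intro q hq
        by_cases hqp : q = p
        · simp [hqp, hdp]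
        · simp [hd q hq hqp, hψ q (Or.inr ⟨hq, hqp⟩)]
      have h2 : ψ q₀ - ψ p * d q₀ = 0 := by
        simpa using LinearMap.congr_fun h1 q₀
      rw [hψ q₀ (Or.inl rfl), zero_sub, neg_eq_zero] at h2
      rcases mul_eq_zero.1 h2 with h | h
      · rw [h, zero_smul, sub_zero] at h1
        exact h1
      · exact absurd h hdq₀.ne)
  obtain ⟨m, hm⟩ := exists_int_of_isUnimodularBasis hunim (fun q hq => hq.2.2) (hlat p (hBV hp))
  simp only [LinearMap.sub_apply, LinearMap.smul_apply, smul_eq_mul, hB p hp, hdp] at hm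
  have hm' : lam = ((1 - m : ℤ) : ℝ) := by push_cast; linarith
  have hpos : 0 < 1 - m := by
    rw [hm'] at hlam0
    exact_mod_cast hlam0
  refine ⟨(1 - m).toNat, by omega, fun q hq => ?_⟩
  have hcast : (((1 - m).toNat : ℕ) : ℝ) = lam := by
    rw [hm']
    exact_mod_cast Int.toNat_of_nonneg hpos.le
  rw [hcast]
  simpa using hg q hq

end SmoothFano

namespace PG

/-- Index set of the vertices of `P(a, b, k, l, α)`. -/
inductive Idx (a b k : ℕ) (l : Fin k → ℕ)
  | v (i : Fin a) : Idx a b k l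
  | y (j : Fin b) : Idx a b k l
  | z : Idx a b k l
  | t : Idx a b k l
  | u (j : Fin b) : Idx a b k l
  | w (j : Fin k) (i : Fin (l j + 1)) : Idx a b k l

namespace Idx

variable {a b k : ℕ} {l : Fin k → ℕ}

/-- The index set as an iterated sum. -/
def equivSum : Idx a b k l ≃
    (Fin a ⊕ Fin b) ⊕ ((Unit ⊕ Unit) ⊕ (Fin b ⊕ Σ j, Fin (l j + 1))) where
  toFun
    | v i => .inl (.inl i)
    | y j => .inl (.inr j)
    | z => .inr (.inl (.inl ()))
    | t => .inr (.inl (.inr ()))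
    | u j => .inr (.inr (.inl j))
    | w j i => .inr (.inr (.inr ⟨j, i⟩))
  invFun
    | .inl (.inl i) => v i
    | .inl (.inr j) => y j
    | .inr (.inl (.inl _)) => z
    | .inr (.inl (.inr _)) => t
    | .inr (.inr (.inl j)) => u j
    | .inr (.inr (.inr ⟨j, i⟩)) => w j i
  left_inv i := by cases i <;> rfl
  right_inv i := by rcases i with (_ | _) | ((_ | _) | (_ | _)) <;> rfl

noncomputable instance : DecidableEq (Idx a b k l) := Classical.decEq _

instance : Fintype (Idx a b k l) := Fintype.ofEquiv _ equivSum.symm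

theorem sum_eq {M : Type*} [AddCommMonoid M] (g : Idx a b k l → M) :
    ∑ i, g i = ((∑ i, g (v i)) + ∑ j, g (y j)) +
      ((g z + g t) + ((∑ j, g (u j)) + ∑ j, ∑ i, g (w j i))) := by
  rw [← Equiv.sum_comp equivSum.symm]
  simp only [Fintype.sum_sum_type, Fintype.sum_sigma, Finset.univ_unique, Finset.sum_singleton]
  rfl

theorem card_eq : Fintype.card (Idx a b k l) = a + 2 * b + 2 + ((∑ j, l j) + k) := by
  rw [Fintype.card_congr equivSum]
  simp [Finset.sum_add_distrib]
  ring

/-- The index of the vertex named by an element of `Fin b ⊕ Fin b`. -/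
def ofSum : Fin b ⊕ Fin b → Idx a b k l := Sum.elim y u

end Idx

/-- The linear relations between the vertices of `P(a, b, k, l, α)`. -/
structure IsRel {a b k : ℕ} {l : Fin k → ℕ} (α : (j : Fin k) → Fin (l j) → (Fin b ⊕ Fin b))
    {M : Type*} [AddCommGroup M] [Module ℝ M] (g : Idx a b k l → M) : Prop where
  z : g .z = -g .t
  vy : (∑ i, g (.v i)) + ∑ j, g (.y j) = ((a : ℝ) + b - 1) • g .t
  u : g .t + ∑ j, g (.u j) = ∑ j, g (.y j)
  w : ∀ j, ∑ i, g (.w j i) = ∑ i, g (.ofSum (α j i))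

theorem IsRel.map {a b k : ℕ} {l : Fin k → ℕ} {α : (j : Fin k) → Fin (l j) → (Fin b ⊕ Fin b)}
    {M N : Type*} [AddCommGroup M] [Module ℝ M] [AddCommGroup N] [Module ℝ N]
    {g : Idx a b k l → M} (hg : IsRel α g) (φ : M →ₗ[ℝ] N) : IsRel α fun i => φ (g i) where
  z := by simp [hg.z]
  vy := by rw [← map_sum, ← map_sum, ← map_add, hg.vy, map_smul]
  u := by rw [← map_sum, ← map_sum, ← map_add, hg.u]
  w j := by rw [← map_sum, ← map_sum, hg.w]

/-- The vertices of `P(a, b, k, l, α)`. -/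
def vec (a b k : ℕ) (l : Fin k → ℕ) (α : (j : Fin k) → Fin (l j) → (Fin b ⊕ Fin b)) :
    Idx a b k l → Fin (dim a b k l) → ℝ
  | .v i => v a b k l i
  | .y j => y a b k l j
  | .z => z a b k l
  | .t => t a b k l
  | .u j => u a b k l j
  | .w j i => w a b k l α j i

theorem P_eq (a b k : ℕ) (l : Fin k → ℕ) (α : (j : Fin k) → Fin (l j) → (Fin b ⊕ Fin b)) :
    P a b k l α = convexHull ℝ (Set.range (vec a b k l α)) := by
  unfold P
  congr 1
  ext q
  simp only [Set.mem_union, Set.mem_range, Set.mem_insert_iff, Set.mem_singleton_iff,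
    Set.mem_iUnion]
  constructor
  · rintro ((((⟨i, rfl⟩ | ⟨i, rfl⟩) | (rfl | rfl)) | ⟨i, rfl⟩) | ⟨j, i, rfl⟩)
    exacts [⟨.v i, rfl⟩, ⟨.y i, rfl⟩, ⟨.z, rfl⟩, ⟨.t, rfl⟩, ⟨.u i, rfl⟩, ⟨.w j i, rfl⟩]
  · rintro ⟨i | i | _ | _ | i | ⟨j, i⟩, rfl⟩
    exacts [.inl (.inl (.inl (.inl ⟨i, rfl⟩))), .inl (.inl (.inl (.inr ⟨i, rfl⟩))),
      .inl (.inl (.inr (.inl rfl))), .inl (.inl (.inr (.inr rfl))), .inl (.inr ⟨i, rfl⟩),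
      .inr ⟨j, i, rfl⟩]

theorem Lprev_eq {k : ℕ} (l : Fin k → ℕ) (j : Fin k) :
    Lprev k l j = ∑ i : Fin j, l (Fin.castLE j.2.le i) := by
  unfold Lprev
  symm
  refine Finset.sum_bij (fun i _ => Fin.castLE j.2.le i) ?_ ?_ ?_ ?_
  · intro i _
    simp only [Finset.mem_filter, Finset.mem_univ, true_and, Fin.lt_def]
    exact i.2
  · intro i _ i' _ h
    simpa [Fin.ext_iff] using h
  · intro i hi
    simp only [Finset.mem_filter, Finset.mem_univ, true_and, Fin.lt_def] at hi
    exact ⟨⟨i, hi⟩, Finset.mem_univ _, rfl⟩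
  · intros
    rfl

section Coordinates

variable (a b k : ℕ) (l : Fin k → ℕ)

/-- Labels for the coordinates of `ℝ^n`. -/
abbrev Coord : Type :=
  ((((Fin a ⊕ Fin b) ⊕ Fin 1) ⊕ Fin b) ⊕ Fin 1) ⊕ Σ j, Fin (l j)

/-- The coordinate carrying a given label. -/
def coordEquiv : Coord a b k l ≃ Fin (dim (a + 1) (b + 1) k l) :=
  (((((finSumFinEquiv.sumCongr (Equiv.refl _)).trans finSumFinEquiv).sumCongr
    (Equiv.refl _)).trans finSumFinEquiv).sumCongr (Equiv.refl _) |>.trans finSumFinEquiv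
    |>.sumCongr finSigmaFinEquiv).trans finSumFinEquiv |>.trans
    (finCongr (by unfold dim; omega))

/-- The standard basis of `ℝ^n`, indexed by labels. -/
noncomputable def coordBasis : Module.Basis (Coord a b k l) ℝ (Fin (dim (a + 1) (b + 1) k l) → ℝ) :=
  (Pi.basisFun ℝ _).reindex (coordEquiv a b k l).symm

theorem coordBasis_apply (d : Coord a b k l) (q : Fin (dim (a + 1) (b + 1) k l)) :
    coordBasis a b k l d q = if q.val = (coordEquiv a b k l d).val then 1 else 0 := by
  simp [coordBasis, Pi.single_apply, Fin.ext_iff]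

variable {a b k l}

theorem coordBasis_v (i : Fin a) (q) : coordBasis a b k l (.inl (.inl (.inl (.inl (.inl i))))) q =
    if q.val = i.val then 1 else 0 := by
  rw [coordBasis_apply]; simp [coordEquiv]

theorem coordBasis_y (j : Fin b) (q) : coordBasis a b k l (.inl (.inl (.inl (.inl (.inr j))))) q =
    if q.val = a + j.val then 1 else 0 := by
  rw [coordBasis_apply]; simp [coordEquiv]

theorem coordBasis_s (q) : coordBasis a b k l (.inl (.inl (.inl (.inr 0)))) q =
    if q.val = a + b then 1 else 0 := by
  rw [coordBasis_apply]; simp [coordEquiv]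

theorem coordBasis_u (j : Fin b) (q) : coordBasis a b k l (.inl (.inl (.inr j))) q =
    if q.val = a + b + 1 + j.val then 1 else 0 := by
  rw [coordBasis_apply]; simp [coordEquiv]

theorem coordBasis_t (q) : coordBasis a b k l (.inl (.inr 0)) q =
    if q.val = a + b + 1 + b then 1 else 0 := by
  rw [coordBasis_apply]; simp [coordEquiv]

theorem coordBasis_w (j : Fin k) (i : Fin (l j)) (q) : coordBasis a b k l (.inr ⟨j, i⟩) q =
    if q.val = a + b + 1 + b + 1 + (Lprev k l j + i.val) then 1 else 0 := by
  rw [coordBasis_apply]; simp [coordEquiv, Lprev_eq, finSigmaFinEquiv_apply]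

theorem sum_ite_eq_add (m c q : ℕ) : (∑ i : Fin m, if q = c + i.val then (1 : ℝ) else 0) =
    if c ≤ q ∧ q < c + m then 1 else 0 := by
  split_ifs with h
  · rw [Fintype.sum_eq_single ⟨q - c, by omega⟩]
    · simp; omega
    · intro i hi
      rw [if_neg]
      intro h'
      exact hi (by ext; simp; omega)
  · refine Finset.sum_eq_zero fun i _ => if_neg ?_
    have := i.2
    omega

variable (α : (j : Fin k) → Fin (l j) → (Fin (b + 1) ⊕ Fin (b + 1)))

theorem vec_v_castSucc (i : Fin a) : vec (a + 1) (b + 1) k l α (.v i.castSucc) =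
    coordBasis a b k l (.inl (.inl (.inl (.inl (.inl i))))) := by
  ext q
  simp [vec, v, coordBasis_v]

theorem vec_v_last : vec (a + 1) (b + 1) k l α (.v (Fin.last a)) =
    ((a : ℝ) + b + 1) • coordBasis a b k l (.inl (.inr 0)) -
      ((∑ i, coordBasis a b k l (.inl (.inl (.inl (.inl (.inl i)))))) +
      (∑ i, coordBasis a b k l (.inl (.inl (.inl (.inl (.inr i)))))) +
      coordBasis a b k l (.inl (.inl (.inl (.inr 0)))) +
      ∑ i, coordBasis a b k l (.inl (.inl (.inr i)))) := by
  ext q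
  have h := sum_ite_eq_add a 0 q
  simp only [zero_add] at h
  simp only [vec, v, Fin.val_last, Pi.sub_apply, Pi.add_apply, Pi.smul_apply, Finset.sum_apply,
    coordBasis_v, coordBasis_y, coordBasis_s, coordBasis_u, coordBasis_t, h, sum_ite_eq_add]
  rw [if_neg (by omega)]
  have : ((a + 1 + (b + 1) - 1 : ℕ) : ℝ) = a + b + 1 := by
    rw [show a + 1 + (b + 1) - 1 = a + b + 1 by omega]; push_cast; rfl
  rw [this]
  split_ifs <;> first | omega | simp

theorem vec_y_castSucc (i : Fin b) : vec (a + 1) (b + 1) k l α (.y i.castSucc) =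
    coordBasis a b k l (.inl (.inl (.inl (.inl (.inr i))))) := by
  ext q
  simp [vec, y, coordBasis_y]

theorem vec_y_last : vec (a + 1) (b + 1) k l α (.y (Fin.last b)) =
    coordBasis a b k l (.inl (.inl (.inl (.inr 0)))) +
      ∑ i, coordBasis a b k l (.inl (.inl (.inr i))) := by
  ext q
  simp only [vec, y, Fin.val_last, Pi.add_apply, Finset.sum_apply,
    coordBasis_s, coordBasis_u, sum_ite_eq_add]
  rw [if_neg (by omega)]
  split_ifs <;> first | omega | simp

theorem vec_t : vec (a + 1) (b + 1) k l α .t = coordBasis a b k l (.inl (.inr 0)) := by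
  ext q
  simp only [vec, t, coordBasis_t]
  split_ifs <;> first | omega | simp

theorem vec_z : vec (a + 1) (b + 1) k l α .z = -coordBasis a b k l (.inl (.inr 0)) := by
  ext q
  simp only [vec, z, coordBasis_t, Pi.neg_apply]
  split_ifs <;> first | omega | simp

theorem vec_u_castSucc (i : Fin b) : vec (a + 1) (b + 1) k l α (.u i.castSucc) =
    coordBasis a b k l (.inl (.inl (.inr i))) := by
  ext q
  have := i.2
  simp only [vec, u, coordBasis_u, Fin.val_castSucc]
  rw [if_pos (by omega)]
  split_ifs <;> first | omega | simp

theorem vec_u_last : vec (a + 1) (b + 1) k l α (.u (Fin.last b)) =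
    (∑ i, coordBasis a b k l (.inl (.inl (.inl (.inl (.inr i)))))) +
      coordBasis a b k l (.inl (.inl (.inl (.inr 0)))) -
      coordBasis a b k l (.inl (.inr 0)) := by
  ext q
  simp only [vec, u, Fin.val_last, Pi.add_apply, Pi.sub_apply, Finset.sum_apply,
    coordBasis_s, coordBasis_t, coordBasis_y, sum_ite_eq_add]
  rw [if_neg (by omega)]
  split_ifs <;> first | omega | simp

theorem vec_w_castSucc (j : Fin k) (i : Fin (l j)) : vec (a + 1) (b + 1) k l α (.w j i.castSucc) =
    coordBasis a b k l (.inr ⟨j, i⟩) := by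
  ext q
  have := i.2
  simp only [vec, w, coordBasis_w, Fin.val_castSucc]
  rw [if_pos (by omega)]
  split_ifs <;> first | omega | simp

theorem vec_ofSum (s : Fin (b + 1) ⊕ Fin (b + 1)) : vec (a + 1) (b + 1) k l α (.ofSum s) =
    Sum.elim (y (a + 1) (b + 1) k l) (u (a + 1) (b + 1) k l) s := by
  cases s <;> rfl

theorem vec_w_last (j : Fin k) : vec (a + 1) (b + 1) k l α (.w j (Fin.last (l j))) =
    (∑ i, vec (a + 1) (b + 1) k l α (.ofSum (α j i))) -
      ∑ i, coordBasis a b k l (.inr ⟨j, i⟩) := by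
  ext q
  have h : ∀ i : Fin (l j), a + b + 1 + b + 1 + (Lprev k l j + i.val) =
      a + b + 1 + b + 1 + Lprev k l j + i.val := fun i => by omega
  simp only [vec_ofSum, Pi.sub_apply, Finset.sum_apply, coordBasis_w, h, sum_ite_eq_add]
  simp only [vec, w, Fin.val_last, A]
  rw [if_neg (by omega)]
  congr 1
  split_ifs <;> first | omega | simp

theorem isRel_vec_succ : IsRel α (vec (a + 1) (b + 1) k l α) where
  z := by rw [vec_z, vec_t]
  vy := by
    simp only [Fin.sum_univ_castSucc, vec_v_castSucc, vec_v_last, vec_y_castSucc, vec_y_last,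
      vec_t]
    push_cast
    module
  u := by
    simp only [Fin.sum_univ_castSucc, vec_u_castSucc, vec_u_last, vec_y_castSucc, vec_y_last,
      vec_t]
    module
  w j := by
    simp only [Fin.sum_univ_castSucc, vec_w_castSucc, vec_w_last]
    module

theorem exists_dual_succ {g : Idx (a + 1) (b + 1) k l → ℝ} (hg : IsRel α g) :
    ∃ φ : (Fin (dim (a + 1) (b + 1) k l) → ℝ) →ₗ[ℝ] ℝ,
      ∀ i, φ (vec (a + 1) (b + 1) k l α i) = g i := by
  let G : Coord a b k l → ℝ
    | .inl (.inl (.inl (.inl (.inl i)))) => g (.v i.castSucc)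
    | .inl (.inl (.inl (.inl (.inr i)))) => g (.y i.castSucc)
    | .inl (.inl (.inl (.inr _))) => g (.y (Fin.last b)) - ∑ i : Fin b, g (.u i.castSucc)
    | .inl (.inl (.inr i)) => g (.u i.castSucc)
    | .inl (.inr _) => g .t
    | .inr ⟨j, i⟩ => g (.w j i.castSucc)
  let φ := (coordBasis a b k l).constr ℝ G
  have hφ : ∀ d, φ (coordBasis a b k l d) = G d := fun d => Module.Basis.constr_basis _ _ _ _
  have hvy := hg.vy
  have hu := hg.u
  simp only [Fin.sum_univ_castSucc, smul_eq_mul] at hvy hu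
  push_cast at hvy
  have hy' : ∀ j, φ (vec (a + 1) (b + 1) k l α (.y j)) = g (.y j) := by
    intro j
    refine Fin.lastCases ?_ (fun j => ?_) j
    · simp [vec_y_last, hφ, G]
    · simp [vec_y_castSucc, hφ, G]
  have hu' : ∀ j, φ (vec (a + 1) (b + 1) k l α (.u j)) = g (.u j) := by
    intro j
    refine Fin.lastCases ?_ (fun j => ?_) j
    · simp only [vec_u_last, map_sub, map_add, map_sum, hφ, G]
      linarith
    · simp [vec_u_castSucc, hφ, G]
  refine ⟨φ, fun i => ?_⟩
  rcases i with i | j | _ | _ | j | ⟨j, i⟩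
  · refine Fin.lastCases ?_ (fun i => ?_) i
    · simp only [vec_v_last, map_sub, map_add, map_sum, map_smul, hφ, G, smul_eq_mul]
      linarith
    · simp [vec_v_castSucc, hφ, G]
  · exact hy' j
  · simp [vec_z, hφ, G, hg.z]
  · simp [vec_t, hφ, G]
  · exact hu' j
  · refine Fin.lastCases ?_ (fun i => ?_) i
    · have h1 : ∀ s, φ (vec (a + 1) (b + 1) k l α (.ofSum s)) = g (.ofSum s) := by
        rintro (s | s)
        exacts [hy' s, hu' s]
      have hw := hg.w j
      simp only [Fin.sum_univ_castSucc] at hw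
      simp only [vec_w_last, map_sub, map_sum, h1, hφ, G]
      linarith
    · simp [vec_w_castSucc, hφ, G]

theorem exists_int_coeff_succ {x : Fin (dim (a + 1) (b + 1) k l) → ℝ} (hx : IsLatticePoint x) :
    ∃ c : Idx (a + 1) (b + 1) k l → ℤ, x = ∑ i, c i • vec (a + 1) (b + 1) k l α i := by
  have hmem : ∀ d, coordBasis a b k l d ∈
      Submodule.span ℤ (Set.range (vec (a + 1) (b + 1) k l α)) := by
    have h : ∀ i, vec (a + 1) (b + 1) k l α i ∈
        Submodule.span ℤ (Set.range (vec (a + 1) (b + 1) k l α)) :=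
      fun i => Submodule.subset_span ⟨i, rfl⟩
    have hu : ∀ i : Fin b, coordBasis a b k l (.inl (.inl (.inr i))) ∈
        Submodule.span ℤ (Set.range (vec (a + 1) (b + 1) k l α)) :=
      fun i => vec_u_castSucc α i ▸ h _
    rintro (((((i | i) | i) | i) | i) | ⟨j, i⟩)
    · exact vec_v_castSucc α i ▸ h _
    · exact vec_y_castSucc α i ▸ h _
    · obtain rfl : i = 0 := Subsingleton.elim _ _
      rw [← add_sub_cancel_right (coordBasis a b k l (.inl (.inl (.inl (.inr 0)))))
        (∑ i, coordBasis a b k l (.inl (.inl (.inr i)))), ← vec_y_last α]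
      exact Submodule.sub_mem _ (h _) (Submodule.sum_mem _ fun i _ => hu i)
    · exact hu i
    · obtain rfl : i = 0 := Subsingleton.elim _ _
      exact vec_t α ▸ h _
    · exact vec_w_castSucc α j i ▸ h _
  have hxmem : x ∈ Submodule.span ℤ (Set.range (vec (a + 1) (b + 1) k l α)) := by
    choose X hX using hx
    have : x = ∑ q, X q • (Pi.single q (1 : ℝ) : Fin (dim (a + 1) (b + 1) k l) → ℝ) := by
      ext q
      simp [Pi.single_apply, hX]
    rw [this]
    refine Submodule.sum_mem _ fun q _ => Submodule.smul_mem _ _ ?_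
    have := hmem ((coordEquiv a b k l).symm q)
    simpa [coordBasis] using this
  obtain ⟨c, hc⟩ := (Submodule.mem_span_range_iff_exists_fun ℤ).1 hxmem
  exact ⟨c, hc.symm⟩

end Coordinates

section Vertices

variable {a b k : ℕ} {l : Fin k → ℕ}

theorem isRel_vec (ha : 2 ≤ a) (hb : 1 ≤ b) (α : (j : Fin k) → Fin (l j) → (Fin b ⊕ Fin b)) :
    IsRel α (vec a b k l α) := by
  obtain ⟨a, rfl⟩ := Nat.exists_eq_add_of_le' (show 1 ≤ a by omega)
  obtain ⟨b, rfl⟩ := Nat.exists_eq_add_of_le' hb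
  exact isRel_vec_succ α

theorem exists_dual (ha : 2 ≤ a) (hb : 1 ≤ b) {α : (j : Fin k) → Fin (l j) → (Fin b ⊕ Fin b)}
    {g : Idx a b k l → ℝ} (hg : IsRel α g) :
    ∃ φ : (Fin (dim a b k l) → ℝ) →ₗ[ℝ] ℝ, ∀ i, φ (vec a b k l α i) = g i := by
  obtain ⟨a, rfl⟩ := Nat.exists_eq_add_of_le' (show 1 ≤ a by omega)
  obtain ⟨b, rfl⟩ := Nat.exists_eq_add_of_le' hb
  exact exists_dual_succ α hg

theorem exists_int_coeff (ha : 2 ≤ a) (hb : 1 ≤ b)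
    (α : (j : Fin k) → Fin (l j) → (Fin b ⊕ Fin b))
    {x : Fin (dim a b k l) → ℝ} (hx : IsLatticePoint x) :
    ∃ c : Idx a b k l → ℤ, x = ∑ i, c i • vec a b k l α i := by
  obtain ⟨a, rfl⟩ := Nat.exists_eq_add_of_le' (show 1 ≤ a by omega)
  obtain ⟨b, rfl⟩ := Nat.exists_eq_add_of_le' hb
  exact exists_int_coeff_succ α hx

end Vertices

section Functionals

variable {a b k : ℕ} {l : Fin k → ℕ}

/-- The linear functional which is `κ` on all vertices apart from `z`, `t` and at most one of the
`v_i`, `y_j`, `u_j` and `w_{i,j}` each, with deficiencies `Y` and `U` at `y_{y₀}` and `u_{u₀}`. -/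
def height (α : (j : Fin k) → Fin (l j) → (Fin b ⊕ Fin b)) (κ Y U : ℝ) (v₀ : Fin a)
    (y₀ u₀ : Fin b) (w₀ : (j : Fin k) → Fin (l j + 1)) : Idx a b k l → ℝ
  | .v i => κ - if i = v₀ then (a + b) * κ - Y - (a + b - 1) * (U - Y) else 0
  | .y j => κ - if j = y₀ then Y else 0
  | .z => -(U - Y)
  | .t => U - Y
  | .u j => κ - if j = u₀ then U else 0
  | .w j i => κ - if i = w₀ j then
      κ + ∑ i, Sum.elim (fun q => if q = y₀ then Y else 0) (fun q => if q = u₀ then U else 0)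
        (α j i) else 0

variable {α : (j : Fin k) → Fin (l j) → (Fin b ⊕ Fin b)}

theorem isRel_height (κ Y U : ℝ) (v₀ : Fin a) (y₀ u₀ : Fin b) (w₀ : (j : Fin k) → Fin (l j + 1)) :
    IsRel α (height α κ Y U v₀ y₀ u₀ w₀) where
  z := rfl
  vy := by
    simp only [height, Finset.sum_sub_distrib, Finset.sum_ite_eq', Finset.mem_univ, if_true,
      Finset.sum_const, Finset.card_univ, Fintype.card_fin, nsmul_eq_mul, smul_eq_mul]
    ring
  u := by
    simp only [height, Finset.sum_sub_distrib, Finset.sum_ite_eq', Finset.mem_univ, if_true,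
      Finset.sum_const, Finset.card_univ, Fintype.card_fin, nsmul_eq_mul]
    ring
  w j := by
    have h : ∀ s, height α κ Y U v₀ y₀ u₀ w₀ (.ofSum s) = κ -
        Sum.elim (fun q => if q = y₀ then Y else 0) (fun q => if q = u₀ then U else 0) s := by
      rintro (s | s) <;> rfl
    simp only [h]
    simp only [height, Finset.sum_sub_distrib, Finset.sum_ite_eq', Finset.mem_univ, if_true,
      Finset.sum_const, Finset.card_univ, Fintype.card_fin, nsmul_eq_mul]
    push_cast
    ring

theorem height_sub (κ Y U κ' Y' U' : ℝ) (v₀ : Fin a) (y₀ u₀ : Fin b)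
    (w₀ : (j : Fin k) → Fin (l j + 1)) (i : Idx a b k l) :
    height α κ Y U v₀ y₀ u₀ w₀ i - height α κ' Y' U' v₀ y₀ u₀ w₀ i =
      height α (κ - κ') (Y - Y') (U - U') v₀ y₀ u₀ w₀ i := by
  have h : ∀ s : Fin b ⊕ Fin b,
      Sum.elim (fun q => if q = y₀ then Y - Y' else 0) (fun q => if q = u₀ then U - U' else 0) s =
      Sum.elim (fun q => if q = y₀ then Y else 0) (fun q => if q = u₀ then U else 0) s -
      Sum.elim (fun q => if q = y₀ then Y' else 0) (fun q => if q = u₀ then U' else 0) s := by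
    rintro (s | s) <;> simp only [Sum.elim_inl, Sum.elim_inr] <;> split_ifs <;> simp
  cases i <;> simp only [height, h, Finset.sum_sub_distrib] <;> (try split_ifs) <;> ring

theorem sum_elim_nonneg {Y U : ℝ} (hY : 0 ≤ Y) (hU : 0 ≤ U) (y₀ u₀ : Fin b) (j : Fin k) :
    0 ≤ ∑ i, Sum.elim (fun q => if q = y₀ then Y else 0) (fun q => if q = u₀ then U else 0)
      (α j i) := by
  refine Finset.sum_nonneg fun i _ => ?_
  rcases α j i with s | s <;> simp only [Sum.elim_inl, Sum.elim_inr] <;> split_ifs <;> simp [*]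

/-- A functional is determined by its values on the vertices of height one. -/
def Spanning (α : (j : Fin k) → Fin (l j) → (Fin b ⊕ Fin b)) (g : Idx a b k l → ℝ) : Prop :=
  ∀ h : Idx a b k l → ℝ, IsRel α h → (∀ i, g i = 1 → h i = 0) → ∀ i, h i = 0

theorem IsRel.eq_zero {h : Idx a b k l → ℝ} (hh : IsRel α h) {v₀ : Fin a} {y₀ u₀ : Fin b}
    {w₀ : (j : Fin k) → Fin (l j + 1)} (hv : ∀ i ≠ v₀, h (.v i) = 0) (hy : ∀ i ≠ y₀, h (.y i) = 0)
    (hu : ∀ i ≠ u₀, h (.u i) = 0) (hw : ∀ j, ∀ i ≠ w₀ j, h (.w j i) = 0)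
    (h0 : (h (.y y₀) = 0 ∧ (h .t = 0 ∨ h (.u u₀) = 0)) ∨ (h (.v v₀) = 0 ∧ h .t = 0)) :
    ∀ i, h i = 0 := by
  have h1 := hh.vy
  have h2 := hh.u
  have h3 := hh.w
  have h4 := hh.z
  rw [Fintype.sum_eq_single v₀ hv, Fintype.sum_eq_single y₀ hy, smul_eq_mul] at h1
  rw [Fintype.sum_eq_single u₀ hu, Fintype.sum_eq_single y₀ hy] at h2
  have ht : h .t = 0 := by
    rcases h0 with ⟨h5, h5' | h5'⟩ | ⟨h5, h5'⟩ <;> linarith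
  rw [ht, mul_zero] at h1
  rw [ht] at h2 h4
  have hy' : h (.y y₀) = 0 := by
    rcases h0 with ⟨h5, h5' | h5'⟩ | ⟨h5, h5'⟩ <;> linarith
  have hv' : ∀ i, h (.v i) = 0 := fun i => by
    by_cases hi : i = v₀
    · rw [hi]; linarith
    · exact hv i hi
  have hyy : ∀ i, h (.y i) = 0 := fun i => by
    by_cases hi : i = y₀
    · rw [hi]; linarith
    · exact hy i hi
  have huu : ∀ i, h (.u i) = 0 := fun i => by
    by_cases hi : i = u₀
    · rw [hi]; linarith
    · exact hu i hi
  have hs : ∀ s, h (.ofSum s) = 0 := by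
    rintro (s | s)
    exacts [hyy s, huu s]
  rintro (i | i | _ | _ | i | ⟨j, i⟩)
  · exact hv' i
  · exact hyy i
  · linarith
  · exact ht
  · exact huu i
  · by_cases hi : i = w₀ j
    · have := h3 j
      rw [Fintype.sum_eq_single (w₀ j) (hw j)] at this
      simpa [hs, hi] using this
    · exact hw j i hi

theorem spanning_height {Y U : ℝ} (v₀ : Fin a) (y₀ u₀ : Fin b) (w₀ : (j : Fin k) → Fin (l j + 1))
    (h : (Y = 0 ∧ (U = 0 ∨ U = 1)) ∨ (Y = 1 ∧ U = 2)) :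
    Spanning α (height α 1 Y U v₀ y₀ u₀ w₀) := by
  intro g hg h0
  refine hg.eq_zero (v₀ := v₀) (y₀ := y₀) (u₀ := u₀) (w₀ := w₀) ?_ ?_ ?_ ?_ ?_
  · exact fun i hi => h0 _ (by simp [height, hi])
  · exact fun i hi => h0 _ (by simp [height, hi])
  · exact fun i hi => h0 _ (by simp [height, hi])
  · exact fun j i hi => h0 _ (by simp [height, hi])
  · rcases h with ⟨rfl, rfl | rfl⟩ | ⟨rfl, rfl⟩
    · exact .inl ⟨h0 _ (by simp [height]), .inr (h0 _ (by simp [height]))⟩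
    · exact .inl ⟨h0 _ (by simp [height]), .inl (h0 _ (by simp [height]))⟩
    · exact .inr ⟨h0 _ (by simp [height]; ring), h0 _ (by simp [height]; norm_num)⟩

/-- `R` lies on the side `g ≤ 1`. -/
def IsValid (α : (j : Fin k) → Fin (l j) → (Fin b ⊕ Fin b)) (R : Set (Fin (dim a b k l) → ℝ))
    (g : Idx a b k l → ℝ) : Prop :=
  ∃ φ : (Fin (dim a b k l) → ℝ) →ₗ[ℝ] ℝ, (∀ i, φ (vec a b k l α i) = g i) ∧
    ∀ q ∈ vertexSet R, φ q ≤ 1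

theorem eq_zero_of_vec (ha : 2 ≤ a) (hb : 1 ≤ b) {ψ : (Fin (dim a b k l) → ℝ) →ₗ[ℝ] ℝ}
    (hψ : ∀ i, ψ (vec a b k l α i) = 0) : ψ = 0 := by
  refine (Pi.basisFun ℝ _).ext fun q => ?_
  obtain ⟨c, hc⟩ := exists_int_coeff ha hb α (x := Pi.basisFun ℝ _ q) (fun i =>
    ⟨if i = q then 1 else 0, by simp [Pi.single_apply]⟩)
  rw [hc, map_sum]
  simp only [map_zsmul, hψ, smul_zero, Finset.sum_const_zero, LinearMap.zero_apply]

theorem Spanning.eq_zero (ha : 2 ≤ a) (hb : 1 ≤ b) {g : Idx a b k l → ℝ} (hg : Spanning α g)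
    (ψ : (Fin (dim a b k l) → ℝ) →ₗ[ℝ] ℝ)
    (hψ : ∀ q ∈ vec a b k l α '' {i | g i = 1}, ψ q = 0) : ψ = 0 :=
  eq_zero_of_vec ha hb
    (hg _ ((isRel_vec ha hb α).map ψ) fun i hi => hψ _ ⟨i, hi, rfl⟩)

variable {R : Set (Fin (dim a b k l) → ℝ)}

theorem exists_neighbour (ha : 2 ≤ a) (hb : 1 ≤ b) (hR : IsSmoothFano R)
    (hV : ∀ i, vec a b k l α i ∈ vertexSet R) {g d : Idx a b k l → ℝ} (hg : Spanning α g)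
    {φ : (Fin (dim a b k l) → ℝ) →ₗ[ℝ] ℝ} (hφ : ∀ i, φ (vec a b k l α i) = g i)
    (hle : ∀ q ∈ vertexSet R, φ q ≤ 1) (hd : IsRel α d) {p : Idx a b k l} (hp : g p = 1)
    (hdp : d p = 1) (hd0 : ∀ i, g i = 1 → i ≠ p → d i = 0) {e : Idx a b k l} (he : d e < 0) :
    ∃ (δ : (Fin (dim a b k l) → ℝ) →ₗ[ℝ] ℝ) (m : ℕ), (∀ i, δ (vec a b k l α i) = d i) ∧
      1 ≤ m ∧ ∀ q ∈ vertexSet R, φ q - m * δ q ≤ 1 := by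
  obtain ⟨δ, hδ⟩ := exists_dual ha hb hd
  obtain ⟨m, hm⟩ := SmoothFano.exists_neighbour hR (f := φ) (d := δ) hle
    (B := vec a b k l α '' {i | g i = 1}) (by rintro _ ⟨i, -, rfl⟩; exact hV i)
    (by rintro _ ⟨i, hi, rfl⟩; exact (hφ i).trans hi) (hg.eq_zero ha hb)
    ⟨p, hp, rfl⟩ ((hδ p).trans hdp)
    (by
      rintro _ ⟨i, hi, rfl⟩ hip
      exact (hδ i).trans (hd0 i hi fun h => hip (h ▸ rfl)))
    (hV e) ((hδ e).trans_lt he)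
  exact ⟨δ, m, hδ, hm⟩

theorem IsValid.flip (ha : 2 ≤ a) (hb : 1 ≤ b) (hR : IsSmoothFano R)
    (hV : ∀ i, vec a b k l α i ∈ vertexSet R) {g d : Idx a b k l → ℝ} (h : IsValid α R g)
    (hg : Spanning α g) (hd : IsRel α d) (p e : Idx a b k l) (hp : g p = 1)
    (hdp : d p = 1) (hd0 : ∀ i, g i = 1 → i ≠ p → d i = 0) (he : g e = 0) (hde : d e = -1) :
    IsValid α R fun i => g i - d i := by
  obtain ⟨φ, hφ, hle⟩ := h
  obtain ⟨δ, m, hδ, hm, hle'⟩ := exists_neighbour ha hb hR hV hg hφ hle hd hp hdp hd0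
    (e := e) (by rw [hde]; norm_num)
  have h1 := hle' _ (hV e)
  rw [hφ, hδ, he, hde] at h1
  have h2 : m = 1 := le_antisymm (by exact_mod_cast (by linarith : (m : ℝ) ≤ 1)) hm
  refine ⟨φ - δ, fun i => by simp [hφ, hδ], fun q hq => ?_⟩
  have h3 := hle' q hq
  rw [h2] at h3
  simpa using h3

end Functionals

section Flips

variable {a b k : ℕ} {l : Fin k → ℕ} {α : (j : Fin k) → Fin (l j) → (Fin b ⊕ Fin b)}
  {R : Set (Fin (dim a b k l) → ℝ)}

theorem isValid_height_flip (ha : 2 ≤ a) (hb : 1 ≤ b) (hR : IsSmoothFano R)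
    (hV : ∀ i, vec a b k l α i ∈ vertexSet R) {Y U : ℝ} (Y' U' : ℝ) {v₀ : Fin a} {y₀ u₀ : Fin b}
    {w₀ : (j : Fin k) → Fin (l j + 1)} (h : IsValid α R (height α 1 Y U v₀ y₀ u₀ w₀))
    (hYU : (Y = 0 ∧ (U = 0 ∨ U = 1)) ∨ (Y = 1 ∧ U = 2)) (p e : Idx a b k l)
    (hp : height α 1 Y U v₀ y₀ u₀ w₀ p = 1)
    (hdp : height α 0 (Y - Y') (U - U') v₀ y₀ u₀ w₀ p = 1)
    (hd0 : ∀ i, height α 1 Y U v₀ y₀ u₀ w₀ i = 1 → i ≠ p →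
      height α 0 (Y - Y') (U - U') v₀ y₀ u₀ w₀ i = 0)
    (he : height α 1 Y U v₀ y₀ u₀ w₀ e = 0)
    (hde : height α 0 (Y - Y') (U - U') v₀ y₀ u₀ w₀ e = -1) :
    IsValid α R (height α 1 Y' U' v₀ y₀ u₀ w₀) := by
  have h1 := h.flip ha hb hR hV (spanning_height v₀ y₀ u₀ w₀ hYU)
    (isRel_height 0 (Y - Y') (U - U') v₀ y₀ u₀ w₀) p e hp hdp hd0 he hde
  simpa only [height_sub, sub_zero, sub_sub_cancel] using h1

theorem height_w_ne_one {Y U : ℝ} (hY : 0 ≤ Y) (hU : 0 ≤ U) (v₀ : Fin a) (y₀ u₀ : Fin b)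
    (w₀ : (j : Fin k) → Fin (l j + 1)) (j : Fin k) :
    height α 1 Y U v₀ y₀ u₀ w₀ (.w j (w₀ j)) ≠ 1 := by
  have := sum_elim_nonneg (α := α) hY hU y₀ u₀ j
  simp only [height, if_true]
  linarith

/-- The heights with `Y = 0` do not depend on `y₀`. -/
theorem height_zero_right (U : ℝ) (v₀ : Fin a) (y₀ y₁ u₀ : Fin b)
    (w₀ : (j : Fin k) → Fin (l j + 1)) :
    height α 1 0 U v₀ y₀ u₀ w₀ = height α 1 0 U v₀ y₁ u₀ w₀ := by
  funext i
  cases i <;> simp [height]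

theorem height_zero_zero (v₀ : Fin a) (y₀ u₀ u₁ : Fin b) (w₀ : (j : Fin k) → Fin (l j + 1)) :
    height α 1 0 0 v₀ y₀ u₀ w₀ = height α 1 0 0 v₀ y₀ u₁ w₀ := by
  funext i
  cases i <;> simp [height]

theorem height_one_two (v₀ v₁ : Fin a) (y₀ u₀ : Fin b) (w₀ : (j : Fin k) → Fin (l j + 1)) :
    height α 1 1 2 v₀ y₀ u₀ w₀ = height α 1 1 2 v₁ y₀ u₀ w₀ := by
  have h : ((a : ℝ) + b) * 1 - 1 - (a + b - 1) * (2 - 1) = 0 := by ring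
  funext i
  cases i <;> simp only [height, h, ite_self]

variable (ha : 2 ≤ a) (hb : 1 ≤ b) (hR : IsSmoothFano R)
  (hV : ∀ i, vec a b k l α i ∈ vertexSet R) {v₀ : Fin a} {y₀ u₀ : Fin b}
  {w₀ : (j : Fin k) → Fin (l j + 1)}

include ha hb hR hV

theorem isValid_one_two (h : IsValid α R (height α 1 0 1 v₀ y₀ u₀ w₀)) :
    IsValid α R (height α 1 1 2 v₀ y₀ u₀ w₀) := by
  have haR : (2 : ℝ) ≤ a := by exact_mod_cast ha
  refine isValid_height_flip ha hb hR hV 1 2 h (.inl ⟨rfl, .inr rfl⟩) (.y y₀) (.v v₀)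
    ?_ ?_ ?_ ?_ ?_
  · simp [height]
  · simp [height]
  · rintro (i | i | _ | _ | i | ⟨j, i⟩) h1 h2
    · by_cases hi : i = v₀
      · subst hi; simp [height] at h1
      · simp [height, hi]
    · have : i ≠ y₀ := fun h => h2 (h ▸ rfl)
      simp [height, this]
    · simp [height]; norm_num
    · simp [height]; norm_num
    · by_cases hi : i = u₀
      · subst hi; simp [height] at h1
      · simp [height, hi]
    · by_cases hi : i = w₀ j
      · subst hi
        exact (height_w_ne_one le_rfl zero_le_one _ _ _ _ _ h1).elim
      · simp [height, hi]
  · simp [height]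
  · simp [height]; norm_num

theorem isValid_zero_one (h : IsValid α R (height α 1 1 2 v₀ y₀ u₀ w₀)) :
    IsValid α R (height α 1 0 1 v₀ y₀ u₀ w₀) := by
  refine isValid_height_flip ha hb hR hV 0 1 h (.inr ⟨rfl, rfl⟩) (.v v₀) (.y y₀)
    ?_ ?_ ?_ ?_ ?_
  · simp [height]; ring
  · simp [height]; norm_num
  · rintro (i | i | _ | _ | i | ⟨j, i⟩) h1 h2
    · have : i ≠ v₀ := fun h => h2 (h ▸ rfl)
      simp [height, this]
    · by_cases hi : i = y₀
      · subst hi; simp [height] at h1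
      · simp [height, hi]
    · simp [height]; norm_num
    · simp [height]; norm_num
    · by_cases hi : i = u₀
      · subst hi; simp [height] at h1
      · simp [height, hi]
    · by_cases hi : i = w₀ j
      · subst hi
        exact (height_w_ne_one zero_le_one zero_le_two _ _ _ _ _ h1).elim
      · simp [height, hi]
  · simp [height]
  · simp [height]

theorem isValid_zero_zero (h : IsValid α R (height α 1 0 1 v₀ y₀ u₀ w₀)) :
    IsValid α R (height α 1 0 0 v₀ y₀ u₀ w₀) := by
  refine isValid_height_flip ha hb hR hV 0 0 h (.inl ⟨rfl, .inr rfl⟩) .t (.u u₀)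
    ?_ ?_ ?_ ?_ ?_
  · simp [height]
  · simp [height]
  · rintro (i | i | _ | _ | i | ⟨j, i⟩) h1 h2
    · by_cases hi : i = v₀
      · subst hi; simp [height] at h1
      · simp [height, hi]
    · simp [height]
    · simp [height] at h1
      linarith
    · exact absurd rfl h2
    · by_cases hi : i = u₀
      · subst hi; simp [height] at h1
      · simp [height, hi]
    · by_cases hi : i = w₀ j
      · subst hi
        exact (height_w_ne_one le_rfl zero_le_one _ _ _ _ _ h1).elim
      · simp [height, hi]
  · simp [height]
  · simp [height]

theorem isValid_zero_one_of_zero_zero (h : IsValid α R (height α 1 0 0 v₀ y₀ u₀ w₀)) :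
    IsValid α R (height α 1 0 1 v₀ y₀ u₀ w₀) := by
  have haR : (2 : ℝ) ≤ a := by exact_mod_cast ha
  have hbR : (1 : ℝ) ≤ b := by exact_mod_cast hb
  refine isValid_height_flip ha hb hR hV 0 1 h (.inl ⟨rfl, .inl rfl⟩) (.u u₀) .t
    ?_ ?_ ?_ ?_ ?_
  · simp [height]
  · simp [height]
  · rintro (i | i | _ | _ | i | ⟨j, i⟩) h1 h2
    · by_cases hi : i = v₀
      · subst hi; simp [height] at h1
        linarith
      · simp [height, hi]
    · simp [height]
    · simp [height] at h1
    · simp [height] at h1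
    · have : i ≠ u₀ := fun h => h2 (h ▸ rfl)
      simp [height, this]
    · by_cases hi : i = w₀ j
      · subst hi
        exact (height_w_ne_one le_rfl le_rfl _ _ _ _ _ h1).elim
      · simp [height, hi]
  · simp [height]
  · simp [height]

theorem isValid_update (h : IsValid α R (height α 1 0 0 v₀ y₀ u₀ w₀)) (j : Fin k)
    (i₁ : Fin (l j + 1)) :
    IsValid α R (height α 1 0 0 v₀ y₀ u₀ (Function.update w₀ j i₁)) := by
  by_cases hi₁ : i₁ = w₀ j
  · rwa [hi₁, Function.update_eq_self]
  have hd : IsRel α fun i : Idx a b k l =>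
      height α 1 0 0 v₀ y₀ u₀ w₀ i - height α 1 0 0 v₀ y₀ u₀ (Function.update w₀ j i₁) i :=
    have h1 := isRel_height (α := α) 1 0 0 v₀ y₀ u₀ w₀
    have h2 := isRel_height (α := α) 1 0 0 v₀ y₀ u₀ (Function.update w₀ j i₁)
    { z := by rw [h1.z, h2.z]; ring
      vy := by
        have h3 := h1.vy
        have h4 := h2.vy
        simp only [smul_eq_mul, Finset.sum_sub_distrib] at *
        linarith
      u := by
        have h3 := h1.u
        have h4 := h2.u
        simp only [Finset.sum_sub_distrib] at *
        linarith
      w := fun j => by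
        rw [Finset.sum_sub_distrib, Finset.sum_sub_distrib, h1.w, h2.w] }
  have h1 := h.flip ha hb hR hV (spanning_height v₀ y₀ u₀ w₀ (.inl ⟨rfl, .inl rfl⟩))
    hd (.w j i₁) (.w j (w₀ j)) ?_ ?_ ?_ ?_ ?_
  · simpa only [sub_sub_cancel] using h1
  · simp [height, hi₁]
  · simp [height, hi₁]
  · rintro (i | i | _ | _ | i | ⟨j', i⟩) h1 h2
    · simp [height]
    · simp [height]
    · simp [height]
    · simp [height]
    · simp [height]
    · have hi : i ≠ w₀ j' := by
        rintro rfl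
        exact (height_w_ne_one le_rfl le_rfl _ _ _ _ _ h1).elim
      by_cases hj : j' = j
      · subst hj
        have : i ≠ i₁ := fun h => h2 (h ▸ rfl)
        simp [height, hi, this]
      · simp [height, hi, Function.update_of_ne hj]
  · simp [height]
  · simp [height, Ne.symm hi₁]

theorem isValid_zero_zero_of_ne (h : IsValid α R (height α 1 0 0 v₀ y₀ u₀ w₀))
    (w₁ : (j : Fin k) → Fin (l j + 1)) : IsValid α R (height α 1 0 0 v₀ y₀ u₀ w₁) := by
  classical
  suffices H : ∀ s : Finset (Fin k), IsValid α R (height α 1 0 0 v₀ y₀ u₀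
      (fun j => if j ∈ s then w₁ j else w₀ j)) by
    simpa using H Finset.univ
  intro s
  induction s using Finset.induction_on with
  | empty => simpa using h
  | insert j s hj ih =>
    convert isValid_update ha hb hR hV ih j (w₁ j) using 2
    funext j'
    by_cases hjj : j' = j
    · subst hjj; simp
    · simp [hjj]

/-- If one of the heights of the family is valid, then all of them are. -/
theorem isValid_of_isValid (h : IsValid α R (height α 1 0 1 v₀ y₀ u₀ w₀)) (v₁ : Fin a)
    (y₁ u₁ : Fin b) (w₁ : (j : Fin k) → Fin (l j + 1)) :
    IsValid α R (height α 1 0 0 v₁ y₁ u₁ w₁) ∧ IsValid α R (height α 1 0 1 v₁ y₁ u₁ w₁) ∧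
      IsValid α R (height α 1 1 2 v₁ y₁ u₁ w₁) := by
  have h1 := isValid_one_two ha hb hR hV h
  rw [height_one_two v₀ v₁] at h1
  have h2 := isValid_zero_zero ha hb hR hV (isValid_zero_one ha hb hR hV h1)
  have h3 := isValid_zero_zero_of_ne ha hb hR hV h2 w₁
  rw [height_zero_zero v₁ y₀ u₀ u₁, height_zero_right 0 v₁ y₀ y₁] at h3
  have h4 := isValid_zero_one_of_zero_zero ha hb hR hV h3
  exact ⟨h3, h4, isValid_one_two ha hb hR hV h4⟩

end Flips

section Coefficients

variable {a b k : ℕ} {l : Fin k → ℕ} {α : (j : Fin k) → Fin (l j) → (Fin b ⊕ Fin b)}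
  {R : Set (Fin (dim a b k l) → ℝ)}

/-- Every lattice point has an expansion in the vertices in which only the coefficient of `t` may
be negative, and which involves neither `z` nor all members of one of the relations. -/
theorem exists_normal_form (ha : 2 ≤ a) (hb : 1 ≤ b)
    (α : (j : Fin k) → Fin (l j) → (Fin b ⊕ Fin b))
    {x : Fin (dim a b k l) → ℝ} (hx : IsLatticePoint x) :
    ∃ c : Idx a b k l → ℤ, x = ∑ i, (c i : ℝ) • vec a b k l α i ∧ c .z = 0 ∧
      (∀ i ≠ .t, 0 ≤ c i) ∧ ((∃ v₀, c (.v v₀) = 0) ∨ ∃ y₀, c (.y y₀) = 0) ∧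
      (∃ u₀, c (.u u₀) = 0) ∧ ∃ w₀ : (j : Fin k) → Fin (l j + 1), ∀ j, c (.w j (w₀ j)) = 0 := by
  obtain ⟨c, hc⟩ := exists_int_coeff ha hb α hx
  have hw : ∀ j, ∃ i₀, ∀ i, c (.w j i₀) ≤ c (.w j i) := fun j => Finite.exists_min _
  choose w₀ hw₀ using hw
  let N : Fin b ⊕ Fin b → ℤ := fun s => ∑ j, ∑ i, if α j i = s then c (.w j (w₀ j)) else 0
  have : Nonempty (Fin b) := ⟨⟨0, hb⟩⟩
  obtain ⟨u₀, hu₀⟩ := Finite.exists_min fun q => c (.u q) + N (.inr q)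
  obtain ⟨m, hm⟩ : ∃ m, m = c (.u u₀) + N (.inr u₀) := ⟨_, rfl⟩
  obtain ⟨p, hp⟩ := Finite.exists_min
    (Sum.elim (fun i : Fin a => c (.v i)) fun q => c (.y q) + N (.inl q) + m)
  obtain ⟨μ, hμ⟩ : ∃ μ, μ = Sum.elim (fun i : Fin a => c (.v i))
    (fun q => c (.y q) + N (.inl q) + m) p := ⟨_, rfl⟩
  rw [← hμ] at hp
  simp only [← hm] at hu₀
  let c' : Idx a b k l → ℤ
    | .v i => c (.v i) - μ
    | .y q => c (.y q) + N (.inl q) + m - μ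
    | .z => 0
    | .t => c .t - c .z - m + (a + b - 1) * μ
    | .u q => c (.u q) + N (.inr q) - m
    | .w j i => c (.w j i) - c (.w j (w₀ j))
  refine ⟨c', ?_, rfl, ?_, ?_, ⟨u₀, ?_⟩, w₀, fun j => ?_⟩
  · have hV := isRel_vec ha hb α
    have hN : (∑ q, (N (.inl q) : ℝ) • vec a b k l α (.y q)) +
        ∑ q, (N (.inr q) : ℝ) • vec a b k l α (.u q) =
        ∑ j, ∑ i, (c (.w j (w₀ j)) : ℝ) • vec a b k l α (.w j i) := by
      have h1 : ∀ s, (N s : ℝ) • vec a b k l α (.ofSum s) = ∑ j, ∑ i,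
          if α j i = s then (c (.w j (w₀ j)) : ℝ) • vec a b k l α (.ofSum s) else 0 := by
        intro s
        simp only [N, Int.cast_sum, Finset.sum_smul, Int.cast_ite, Int.cast_zero, ite_smul,
          zero_smul]
      have h2 : ∑ s, (N s : ℝ) • vec a b k l α (.ofSum s) =
          ∑ j, ∑ i, (c (.w j (w₀ j)) : ℝ) • vec a b k l α (.ofSum (α j i)) := by
        simp only [h1]
        rw [Finset.sum_comm]
        refine Finset.sum_congr rfl fun j _ => ?_
        rw [Finset.sum_comm]
        exact Finset.sum_congr rfl fun i _ => by rw [Finset.sum_ite_eq]; simp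
      rw [Fintype.sum_sum_type] at h2
      simp only [← Finset.smul_sum, hV.w]
      simp only [Finset.smul_sum]
      exact h2
    have h1 := hV.vy
    have h2 := hV.u
    have h3 := hV.z
    rw [hc]
    simp only [← Int.cast_smul_eq_zsmul ℝ, Idx.sum_eq, c']
    push_cast
    simp only [sub_smul, add_smul, Finset.sum_sub_distrib, Finset.sum_add_distrib]
    rw [← hN]
    simp only [← Finset.smul_sum]
    linear_combination (norm := module) (μ : ℝ) • h1 + (m : ℝ) • h2 + (c .z : ℝ) • h3
  · rintro (i | q | _ | _ | q | ⟨j, i⟩) hi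
    · exact sub_nonneg.2 (hp (.inl i))
    · exact sub_nonneg.2 (hp (.inr q))
    · exact le_rfl
    · exact absurd rfl hi
    · exact sub_nonneg.2 (hu₀ q)
    · exact sub_nonneg.2 (hw₀ j i)
  · rcases p with v₀ | y₀
    · exact .inl ⟨v₀, by simp [c', hμ]⟩
    · exact .inr ⟨y₀, by simp [c', hμ]⟩
  · simp [c', hm]
  · simp [c']

theorem map_sum_eq {φ : (Fin (dim a b k l) → ℝ) →ₗ[ℝ] ℝ} {g : Idx a b k l → ℝ}
    (hφ : ∀ i, φ (vec a b k l α i) = g i) {c : Idx a b k l → ℤ} {κ : ℝ}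
    (hg : ∀ i ≠ .t, c i ≠ 0 → g i = κ) :
    φ (∑ i, (c i : ℝ) • vec a b k l α i) =
      ((∑ i ∈ Finset.univ.erase .t, c i : ℤ) : ℝ) * κ + c .t * g .t := by
  rw [map_sum, ← Finset.sum_erase_add _ _ (Finset.mem_univ Idx.t)]
  simp only [map_smul, hφ, smul_eq_mul, Int.cast_sum, Finset.sum_mul]
  congr 1
  refine Finset.sum_congr rfl fun i hi => ?_
  by_cases h : c i = 0
  · simp [h]
  · rw [hg i (Finset.ne_of_mem_erase hi) h]

theorem height_le_one {Y U : ℝ} (h : (Y = 0 ∧ (U = 0 ∨ U = 1)) ∨ (Y = 1 ∧ U = 2)) (v₀ : Fin a)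
    (y₀ u₀ : Fin b) (w₀ : (j : Fin k) → Fin (l j + 1)) (i : Idx a b k l) :
    height α 1 Y U v₀ y₀ u₀ w₀ i ≤ 1 := by
  have hY : 0 ≤ Y := by rcases h with ⟨rfl, rfl | rfl⟩ | ⟨rfl, rfl⟩ <;> norm_num
  have hU : 0 ≤ U := by rcases h with ⟨rfl, rfl | rfl⟩ | ⟨rfl, rfl⟩ <;> norm_num
  have hA : 0 ≤ ((a : ℝ) + b) * 1 - Y - (a + b - 1) * (U - Y) := by
    have haR : (0 : ℝ) ≤ a := Nat.cast_nonneg a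
    have hbR : (0 : ℝ) ≤ b := Nat.cast_nonneg b
    rcases h with ⟨rfl, rfl | rfl⟩ | ⟨rfl, rfl⟩ <;> linarith
  rcases i with i | i | _ | _ | i | ⟨j, i⟩ <;> simp only [height]
  · split_ifs <;> linarith
  · split_ifs <;> linarith
  · rcases h with ⟨rfl, rfl | rfl⟩ | ⟨rfl, rfl⟩ <;> norm_num
  · rcases h with ⟨rfl, rfl | rfl⟩ | ⟨rfl, rfl⟩ <;> norm_num
  · split_ifs <;> linarith
  · have := sum_elim_nonneg (α := α) hY hU y₀ u₀ j
    split_ifs <;> linarith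

/-- A nonzero extreme point is not a proper multiple of another point. -/
theorem eq_zero_of_eq_smul {n : ℕ} {R : Set (Fin n → ℝ)} {p q : Fin n → ℝ} {c : ℝ}
    (hp : p ∈ vertexSet R) (h0 : 0 ∈ R) (hq : q ∈ R) (hc0 : 0 ≤ c) (hc1 : c < 1)
    (h : p = c • q) : p = 0 := by
  rcases hc0.eq_or_lt with rfl | hc
  · rw [h, zero_smul]
  · exact ((mem_extremePoints.1 hp).2 0 h0 q hq
      ⟨1 - c, c, by linarith, hc, by ring, by rw [h, smul_zero, zero_add]⟩).1.symm

end Coefficients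

section Superpolytope

variable {a b k : ℕ} {l : Fin k → ℕ} {α : (j : Fin k) → Fin (l j) → (Fin b ⊕ Fin b)}
  {R : Set (Fin (dim a b k l) → ℝ)} {x : Fin (dim a b k l) → ℝ}

theorem isValid_of_neg_eq_sum (ha : 2 ≤ a) (hb : 1 ≤ b) (hR : IsSmoothFano R)
    (hVR : vertexSet R = insert x (Set.range (vec a b k l α))) {g : Idx a b k l → ℝ}
    (hg : IsRel α g) (hle : ∀ i, g i ≤ 1) (ht : g .t = 1) {c : Idx a b k l → ℤ}
    (hc : ∀ i ≠ .t, 0 ≤ c i) (hc1 : ∀ i ≠ .t, c i ≠ 0 → g i = 1)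
    (hx : -x = ∑ i, (c i : ℝ) • vec a b k l α i) : IsValid α R g := by
  obtain ⟨φ, hφ⟩ := exists_dual ha hb hg
  refine ⟨φ, hφ, ?_⟩
  rw [hVR]
  rintro q (rfl | ⟨i, rfl⟩)
  swap
  · rw [hφ]; exact hle i
  by_contra! hlt
  have h1 := map_sum_eq hφ hc1
  rw [← hx, map_neg, ht, mul_one, mul_one] at h1
  obtain ⟨S, hS⟩ : ∃ S, S = ∑ i ∈ Finset.univ.erase Idx.t, c i := ⟨_, rfl⟩
  rw [← hS] at h1
  have hS0 : 0 ≤ S := hS ▸ Finset.sum_nonneg fun i hi => hc i (Finset.ne_of_mem_erase hi)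
  have hS0R : (0 : ℝ) ≤ S := by exact_mod_cast hS0
  have hT : 1 + (S : ℝ) < -c .t := by linarith
  have hRconv : Convex ℝ R := by
    rw [(SmoothFano.finite_vertexSet hR).2.2]
    exact convex_convexHull ℝ _
  have hV : ∀ p ∈ vertexSet R, p ∈ R := fun p hp => extremePoints_subset hp
  have hmem : (1 + (S : ℝ))⁻¹ • (q + ∑ i ∈ Finset.univ.erase .t, (c i : ℝ) • vec a b k l α i) ∈
      R := by
    have h2 := hRconv.sum_mem (t := Finset.univ)
      (w := fun i : Idx a b k l => (1 + (S : ℝ))⁻¹ * if i = .t then 1 else (c i : ℝ))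
      (z := fun i => if i = .t then q else vec a b k l α i) ?_ ?_ ?_
    · convert h2 using 1
      rw [← Finset.sum_erase_add _ _ (Finset.mem_univ Idx.t), smul_add, add_comm,
        Finset.smul_sum]
      congr 1
      · refine Finset.sum_congr rfl fun i hi => ?_
        simp [Finset.ne_of_mem_erase hi, mul_smul]
      · simp
    · intro i _
      refine mul_nonneg (inv_nonneg.2 (by linarith)) ?_
      split_ifs with h
      · exact zero_le_one
      · exact_mod_cast hc i h
    · rw [← Finset.mul_sum, ← Finset.sum_erase_add _ _ (Finset.mem_univ Idx.t), if_pos rfl,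
        Finset.sum_congr rfl (g := fun i => (c i : ℝ))
          fun i hi => if_neg (Finset.ne_of_mem_erase hi), ← Int.cast_sum, ← hS, add_comm,
        inv_mul_cancel₀ (by linarith)]
    · intro i _
      split_ifs
      · exact hV _ (hVR ▸ .inl rfl)
      · exact hV _ (hVR ▸ .inr ⟨i, rfl⟩)
  have h3 : vec a b k l α .t = ((1 + (S : ℝ)) / -c .t) •
      ((1 + (S : ℝ))⁻¹ • (q + ∑ i ∈ Finset.univ.erase .t, (c i : ℝ) • vec a b k l α i)) := by
    rw [← Finset.sum_erase_add _ _ (Finset.mem_univ Idx.t)] at hx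
    have h4 : q + ∑ i ∈ Finset.univ.erase .t, (c i : ℝ) • vec a b k l α i =
        (-c .t : ℝ) • vec a b k l α .t := by
      linear_combination (norm := module) -hx
    have h5 : (1 + (S : ℝ)) ≠ 0 := by linarith
    have h6 : (-c .t : ℝ) ≠ 0 := by linarith
    rw [h4, smul_smul, smul_smul, div_mul_eq_mul_div, mul_inv_cancel₀ h5, one_div,
      inv_mul_cancel₀ h6, one_smul]
  have h7 := eq_zero_of_eq_smul (hVR ▸ .inr ⟨_, rfl⟩) (interior_subset hR.2.1) hmem
    (div_nonneg (by linarith) (by linarith)) ((div_lt_one (by linarith)).2 hT) h3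
  have h8 := hφ .t
  rw [h7, map_zero, ht] at h8
  exact zero_ne_one h8

theorem exists_isValid (ha : 2 ≤ a) (hb : 1 ≤ b) (hR : IsSmoothFano R)
    (hVR : vertexSet R = insert x (Set.range (vec a b k l α))) :
    ∃ v₀ y₀ u₀ w₀, IsValid α R (height α 1 0 1 v₀ y₀ u₀ w₀) := by
  have hxlat : IsLatticePoint (-x) := fun q => by
    obtain ⟨m, hm⟩ := (SmoothFano.finite_vertexSet hR).2.1 x (hVR ▸ .inl rfl) q
    exact ⟨-m, by simp [hm]⟩
  obtain ⟨c, hx, hz, hc, hvy, ⟨u₀, hu₀⟩, w₀, hw₀⟩ := exists_normal_form ha hb α hxlat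
  rcases hvy with ⟨v₀, hv₀⟩ | ⟨y₀, hy₀⟩
  · refine ⟨v₀, ⟨0, hb⟩, u₀, w₀, isValid_of_neg_eq_sum ha hb hR hVR (isRel_height ..)
      (height_le_one (.inl ⟨rfl, .inr rfl⟩) _ _ _ _) (by simp [height]) hc ?_ hx⟩
    rintro (i | i | _ | _ | i | ⟨j, i⟩) hi hci
    · have : i ≠ v₀ := by rintro rfl; exact hci hv₀
      simp [height, this]
    · simp [height]
    · exact absurd hz hci
    · exact absurd rfl hi
    · have : i ≠ u₀ := by rintro rfl; exact hci hu₀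
      simp [height, this]
    · have : i ≠ w₀ j := by rintro rfl; exact hci (hw₀ j)
      simp [height, this]
  · refine ⟨⟨0, by omega⟩, y₀, u₀, w₀, isValid_zero_one ha hb hR (fun i => hVR ▸ .inr ⟨i, rfl⟩)
      (isValid_of_neg_eq_sum ha hb hR hVR (isRel_height ..)
      (height_le_one (.inr ⟨rfl, rfl⟩) _ _ _ _) (by simp [height]; norm_num) hc ?_ hx)⟩
    rintro (i | i | _ | _ | i | ⟨j, i⟩) hi hci
    · simp [height]; intro; ring
    · have : i ≠ y₀ := by rintro rfl; exact hci hy₀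
      simp [height, this]
    · exact absurd hz hci
    · exact absurd rfl hi
    · have : i ≠ u₀ := by rintro rfl; exact hci hu₀
      simp [height, this]
    · have : i ≠ w₀ j := by rintro rfl; exact hci (hw₀ j)
      simp [height, this]

end Superpolytope

section Superpolytope

variable {a b k : ℕ} {l : Fin k → ℕ} {α : (j : Fin k) → Fin (l j) → (Fin b ⊕ Fin b)}
  {R : Set (Fin (dim a b k l) → ℝ)} {x : Fin (dim a b k l) → ℝ}

theorem zero_notMem_vertexSet (ha : 2 ≤ a) (hb : 1 ≤ b)
    (hV : ∀ i, vec a b k l α i ∈ vertexSet R) : 0 ∉ vertexSet R := by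
  intro h0
  have hz : vec a b k l α .z = 0 := (mem_extremePoints.1 h0).2 _ (extremePoints_subset (hV .z)) _
    (extremePoints_subset (hV .t))
    ⟨1 / 2, 1 / 2, by norm_num, by norm_num, by norm_num,
      by rw [(isRel_vec ha hb α).z]; module⟩ |>.1
  obtain ⟨φ, hφ⟩ := exists_dual ha hb
    (isRel_height (α := α) 1 0 1 ⟨0, by omega⟩ ⟨0, hb⟩ ⟨0, hb⟩ fun _ => 0)
  have h1 := hφ .z
  rw [hz, map_zero] at h1
  simp [height] at h1

/-- An additional vertex is not a multiple of `t`. -/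
theorem ne_smul_t (ha : 2 ≤ a) (hb : 1 ≤ b) (hR : IsSmoothFano R)
    (hV : ∀ i, vec a b k l α i ∈ vertexSet R) (hxV : x ∈ vertexSet R)
    (hx : x ∉ Set.range (vec a b k l α)) {v₀ : Fin a} {y₀ u₀ : Fin b}
    {w₀ : (j : Fin k) → Fin (l j + 1)} (h : IsValid α R (height α 1 0 1 v₀ y₀ u₀ w₀)) (m : ℤ) :
    x ≠ (m : ℝ) • vec a b k l α .t := by
  intro hm
  have h0 := zero_notMem_vertexSet ha hb hV
  have hz := (isRel_vec ha hb α).z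
  obtain ⟨φ, hφ, hle⟩ := h
  have h1 := hle x hxV
  rw [hm, map_smul, hφ] at h1
  simp only [height, sub_zero, smul_eq_mul, mul_one] at h1
  have h2 : m ≤ 1 := by exact_mod_cast h1
  obtain rfl | rfl | rfl | h3 : m = 1 ∨ m = 0 ∨ m = -1 ∨ m ≤ -2 := by omega
  · exact hx ⟨.t, by simp [hm]⟩
  · rw [Int.cast_zero, zero_smul] at hm
    exact h0 (hm ▸ hxV)
  · exact hx ⟨.z, by simp [hm, hz]⟩
  · have h4 : (m : ℝ) ≤ -2 := by exact_mod_cast h3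
    refine h0 (eq_zero_of_eq_smul (hV .z) (interior_subset hR.2.1) (extremePoints_subset hxV)
      (c := (-m : ℝ)⁻¹) (inv_nonneg.2 (by linarith)) (inv_lt_one_of_one_lt₀ (by linarith)) ?_ ▸
      hV .z)
    rw [hm, smul_smul, hz, inv_neg, neg_mul, inv_mul_cancel₀ (by linarith), neg_one_smul]

theorem vertexSet_ne_insert (ha : 2 ≤ a) (hb : 1 ≤ b) (hR : IsSmoothFano R)
    (hx : x ∉ Set.range (vec a b k l α)) :
    vertexSet R ≠ insert x (Set.range (vec a b k l α)) := by
  intro hVR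
  have hV : ∀ i, vec a b k l α i ∈ vertexSet R := fun i => hVR ▸ .inr ⟨i, rfl⟩
  have hxV : x ∈ vertexSet R := hVR ▸ .inl rfl
  obtain ⟨_, _, _, _, hvalid⟩ := exists_isValid ha hb hR hVR
  replace hvalid := isValid_of_isValid ha hb hR hV hvalid
  obtain ⟨c, hc, hz, hc0, hvy, ⟨u₀, hu₀⟩, w₀, hw₀⟩ :=
    exists_normal_form ha hb α ((SmoothFano.finite_vertexSet hR).2.1 x hxV)
  obtain ⟨S, hS⟩ : ∃ S, S = ∑ i ∈ Finset.univ.erase Idx.t, c i := ⟨_, rfl⟩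
  have hS0 : ∀ i ∈ Finset.univ.erase Idx.t, 0 ≤ c i :=
    fun i hi => hc0 i (Finset.ne_of_mem_erase hi)
  by_cases hv : ∃ v₀, c (.v v₀) = 0
  · obtain ⟨v₀, hv₀⟩ := hv
    obtain ⟨φ, hφ, hle⟩ := (hvalid v₀ u₀ u₀ w₀).1
    have h1 : ∀ i ≠ .t, c i ≠ 0 → height α 1 0 0 v₀ u₀ u₀ w₀ i = 1 := by
      rintro (i | i | _ | _ | i | ⟨j, i⟩) hi hci
      · have : i ≠ v₀ := by rintro rfl; exact hci hv₀
        simp [height, this]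
      · simp [height]
      · exact absurd hz hci
      · exact absurd rfl hi
      · simp [height]
      · have : i ≠ w₀ j := by rintro rfl; exact hci (hw₀ j)
        simp [height, this]
    have h2 := map_sum_eq hφ h1
    rw [← hc, ← hS] at h2
    simp only [height, sub_zero, mul_zero, mul_one, add_zero] at h2
    have h3 := hle x hxV
    have h4 : S ≠ 1 := by
      rintro rfl
      have hsp := spanning_height (α := α) (Y := 0) (U := 0) v₀ u₀ u₀ w₀ (.inl ⟨rfl, .inl rfl⟩)
      obtain ⟨i, -, hi⟩ := SmoothFano.mem_of_spanning hR hle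
        (B := vec a b k l α '' {i | height α 1 0 0 v₀ u₀ u₀ w₀ i = 1})
        ⟨_, .y u₀, by simp [height], rfl⟩ (by rintro _ ⟨i, -, rfl⟩; exact hV i)
        (by rintro _ ⟨i, hi, rfl⟩; exact (hφ i).trans hi) (hsp.eq_zero ha hb) hxV
        (by rw [h2, Int.cast_one])
      exact hx ⟨i, hi⟩
    rw [h2] at h3
    have h5 : S ≤ 1 := by exact_mod_cast h3
    have h6 : 0 ≤ S := hS ▸ Finset.sum_nonneg hS0
    have h7 := (Finset.sum_eq_zero_iff_of_nonneg hS0).1 (hS ▸ (by omega : S = 0))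
    refine ne_smul_t ha hb hR hV hxV hx (hvalid v₀ u₀ u₀ w₀).2.1 (c .t) ?_
    rw [← Finset.sum_erase_add _ _ (Finset.mem_univ Idx.t), Finset.sum_eq_zero, zero_add] at hc
    · exact hc
    · intro i hi
      rw [h7 i hi, Int.cast_zero, zero_smul]
  · obtain ⟨y₀, hy₀⟩ := hvy.resolve_left hv
    push Not at hv
    let v₀ : Fin a := ⟨0, by omega⟩
    have hS2 : 2 ≤ S := by
      have h1 : ∑ i : Fin a, c (.v i) ≤ S := by
        rw [hS, ← Finset.sum_image (f := c) (g := Idx.v) (by intro i _ j _ h; simpa using h)]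
        refine Finset.sum_le_sum_of_subset_of_nonneg ?_ fun i hi _ => hS0 i hi
        intro i hi
        obtain ⟨i, -, rfl⟩ := Finset.mem_image.1 hi
        simp
      have h2 : ∑ _i : Fin a, (1 : ℤ) ≤ ∑ i : Fin a, c (.v i) :=
        Finset.sum_le_sum fun i _ => by
          have := hc0 (.v i) (by simp)
          have := hv i
          omega
      simp only [Finset.sum_const, Finset.card_univ, Fintype.card_fin, nsmul_eq_mul, mul_one] at h2
      omega
    obtain ⟨φ, hφ, hle⟩ := (hvalid v₀ y₀ u₀ w₀).2.2
    have h1 : ∀ i ≠ .t, c i ≠ 0 → height α 1 1 2 v₀ y₀ u₀ w₀ i = 1 ∧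
        height α 0 (-(a + b - 1)) (-(a + b - 2)) v₀ y₀ u₀ w₀ i = 0 := by
      rintro (i | i | _ | _ | i | ⟨j, i⟩) hi hci
      · simp only [height]
        constructor <;> split_ifs <;> ring
      · have : i ≠ y₀ := by rintro rfl; exact hci hy₀
        simp [height, this]
      · exact absurd hz hci
      · exact absurd rfl hi
      · have : i ≠ u₀ := by rintro rfl; exact hci hu₀
        simp [height, this]
      · have : i ≠ w₀ j := by rintro rfl; exact hci (hw₀ j)
        simp [height, this]
    obtain ⟨δ, m, hδ, hm, hle'⟩ := exists_neighbour ha hb hR hV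
      (spanning_height v₀ y₀ u₀ w₀ (.inr ⟨rfl, rfl⟩)) hφ hle
      (isRel_height 0 (-(a + b - 1)) (-(a + b - 2)) v₀ y₀ u₀ w₀) (p := .t)
      (by simp only [height]; ring) (by simp only [height]; ring) (by
        rintro (i | i | _ | _ | i | ⟨j, i⟩) h1 h2
        · simp only [height]
          split_ifs <;> ring
        · have : i ≠ y₀ := by rintro rfl; simp [height] at h1
          simp [height, this]
        · simp only [height] at h1
          norm_num at h1
        · exact absurd rfl h2
        · have : i ≠ u₀ := by rintro rfl; simp [height] at h1
          simp [height, this]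
        · have : i ≠ w₀ j := by
            rintro rfl
            exact height_w_ne_one zero_le_one zero_le_two _ _ _ _ _ h1
          simp [height, this]) (e := .z) (by simp only [height]; linarith)
    have h2 := map_sum_eq hφ fun i hi hci => (h1 i hi hci).1
    have h3 := map_sum_eq hδ fun i hi hci => (h1 i hi hci).2
    have h4 := hle' x hxV
    have h5 := hle' _ (hV .z)
    have h6 := hle x hxV
    rw [← hc, ← hS] at h2
    rw [← hc] at h3
    rw [hφ, hδ] at h5
    simp only [height] at h2 h3 h5
    have hT : (-((a : ℝ) + b - 2) - -(a + b - 1)) = 1 := by ring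
    rw [hT] at h3 h5
    norm_num at h2 h3 h5
    rw [h2, h3] at h4
    rw [h2] at h6
    have hS2' : (2 : ℝ) ≤ S := by exact_mod_cast hS2
    obtain rfl | rfl : m = 1 ∨ m = 2 := by omega
    · norm_num at h4
      linarith
    · norm_num at h4
      linarith

end Superpolytope

section Vertices

variable {a b k : ℕ} {l : Fin k → ℕ}

/-- The functional with given values on the `v_i`, `y_j`, `t` and `u_j` which is constant on
each of the groups `w_{1,j}, …, w_{l_j+1,j}`. -/
noncomputable def extend (α : (j : Fin k) → Fin (l j) → (Fin b ⊕ Fin b)) (V : Fin a → ℝ)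
    (Y U : Fin b → ℝ) (T : ℝ) : Idx a b k l → ℝ
  | .v i => V i
  | .y j => Y j
  | .z => -T
  | .t => T
  | .u j => U j
  | .w j _ => (∑ i, Sum.elim Y U (α j i)) / (l j + 1)

variable {α : (j : Fin k) → Fin (l j) → (Fin b ⊕ Fin b)}

theorem isRel_extend {V : Fin a → ℝ} {Y U : Fin b → ℝ} {T : ℝ}
    (h1 : ∑ i, V i + ∑ j, Y j = (a + b - 1) * T) (h2 : T + ∑ j, U j = ∑ j, Y j) :
    IsRel α (extend α V Y U T) where
  z := rfl
  vy := h1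
  u := h2
  w j := by
    have h : ∀ s, extend α V Y U T (.ofSum s) = Sum.elim Y U s := by
      rintro (s | s) <;> rfl
    simp only [h]
    simp only [extend, Finset.sum_const, Finset.card_univ, Fintype.card_fin, nsmul_eq_mul]
    push_cast
    exact mul_div_cancel₀ _ (by positivity)

theorem extend_w_lt_one {V : Fin a → ℝ} {Y U : Fin b → ℝ} {T : ℝ} (hY : ∀ j, Y j ≤ 1)
    (hU : ∀ j, U j ≤ 1) (j : Fin k) (i : Fin (l j + 1)) : extend α V Y U T (.w j i) < 1 := by
  have h : ∑ i, Sum.elim Y U (α j i) ≤ ∑ _i : Fin (l j), (1 : ℝ) := by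
    refine Finset.sum_le_sum fun i _ => ?_
    rcases α j i with s | s
    exacts [hY s, hU s]
  simp only [Finset.sum_const, Finset.card_univ, Fintype.card_fin, nsmul_eq_mul, mul_one] at h
  have hl : (0 : ℝ) < l j + 1 := by positivity
  simp only [extend]
  rw [div_lt_one hl]
  linarith

/-- Each of the generators of `P(a, b, k, l, α)` is the unique maximiser of some functional. -/
theorem exists_isRel_lt (ha : 2 ≤ a) (hb : 1 ≤ b) (hl : ∀ j, 1 ≤ l j) (i : Idx a b k l) :
    ∃ g : Idx a b k l → ℝ, IsRel α g ∧ g i = 1 ∧ ∀ i' ≠ i, g i' < 1 := by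
  have haR : (2 : ℝ) ≤ a := by exact_mod_cast ha
  have hbR : (1 : ℝ) ≤ b := by exact_mod_cast hb
  obtain ⟨τ, hτ⟩ : ∃ τ : ℝ, τ = 1 / (a + b) := ⟨_, rfl⟩
  have hτ0 : 0 < τ := by rw [hτ]; positivity
  have hτ1 : τ < 1 := by rw [hτ, div_lt_one (by linarith)]; linarith
  have hτab : (a + b) * τ = 1 := by rw [hτ]; field_simp
  have hdiv : ∀ r : ℝ, r < 1 → r / b < 1 := fun r hr => by
    rw [div_lt_one (by linarith)]; linarith
  have hdiv' : ∀ r : ℝ, r < 1 → r / a < 1 := fun r hr => by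
    rw [div_lt_one (by linarith)]; linarith
  have hcast : ((a - 1 : ℕ) : ℝ) = a - 1 := by rw [Nat.cast_sub (by omega), Nat.cast_one]
  rcases i with i₀ | j₀ | _ | _ | j₀ | ⟨j₀, i₀⟩
  · refine ⟨extend α (fun i => if i = i₀ then 1 else -1 / (a - 1)) 0 0 0,
      isRel_extend ?_ (by simp), by simp [extend], ?_⟩
    · rw [← Finset.sum_erase_add _ _ (Finset.mem_univ i₀), Finset.sum_congr rfl
        (g := fun _ => (-1 / (a - 1) : ℝ)) fun i hi => if_neg (Finset.ne_of_mem_erase hi)]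
      simp only [Finset.sum_const, Finset.card_erase_of_mem (Finset.mem_univ _),
        Finset.card_univ, Fintype.card_fin, nsmul_eq_mul, hcast, Pi.zero_apply]
      have : (a : ℝ) - 1 ≠ 0 := by linarith
      field_simp
      simp
    · rintro (i | j | _ | _ | j | ⟨j, i⟩) hi
      · have : i ≠ i₀ := fun h => hi (h ▸ rfl)
        simp only [extend, if_neg this]
        have : (-1 : ℝ) / (a - 1) < 0 := div_neg_of_neg_of_pos (by norm_num) (by linarith)
        linarith
      · simp [extend]
      · simp [extend]
      · simp [extend]
      · simp [extend]
      · exact extend_w_lt_one (by simp) (by simp) j i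
  · refine ⟨extend α (fun _ => (-τ) / a) (fun j => if j = j₀ then 1 else 0)
      (fun _ => (1 - τ) / b) τ, isRel_extend ?_ ?_, by simp [extend], ?_⟩
    · simp only [Finset.sum_const, Finset.card_univ, Fintype.card_fin, nsmul_eq_mul,
        Finset.sum_ite_eq', Finset.mem_univ, if_true]
      rw [mul_div_cancel₀ _ (by linarith)]
      linarith
    · simp only [Finset.sum_const, Finset.card_univ, Fintype.card_fin, nsmul_eq_mul,
        Finset.sum_ite_eq', Finset.mem_univ, if_true]
      rw [mul_div_cancel₀ _ (by linarith)]
      ring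
    · rintro (i | j | _ | _ | j | ⟨j, i⟩) hi
      · exact hdiv' _ (by linarith)
      · have : j ≠ j₀ := fun h => hi (h ▸ rfl)
        simp [extend, this]
      · simp only [extend]; linarith
      · exact hτ1
      · exact hdiv _ (by linarith)
      · exact extend_w_lt_one (fun j => by split_ifs <;> norm_num)
          (fun j => (hdiv _ (by linarith)).le) j i
  · refine ⟨extend α (fun _ => (2 - a - b) / a) (fun _ => -1 / b) 0 (-1),
      isRel_extend ?_ ?_, by simp [extend], ?_⟩
    · simp only [Finset.sum_const, Finset.card_univ, Fintype.card_fin, nsmul_eq_mul]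
      rw [mul_div_cancel₀ _ (by linarith), mul_div_cancel₀ _ (by linarith)]
      ring
    · simp only [Finset.sum_const, Finset.card_univ, Fintype.card_fin, nsmul_eq_mul]
      rw [mul_div_cancel₀ _ (by linarith)]
      simp
    · rintro (i | j | _ | _ | j | ⟨j, i⟩) hi
      · exact hdiv' _ (by linarith)
      · exact hdiv _ (by linarith)
      · exact absurd rfl hi
      · simp only [extend]; linarith
      · simp [extend]
      · exact extend_w_lt_one (fun j => (hdiv _ (by linarith)).le) (by simp) j i
  · refine ⟨extend α (fun _ => 1 - τ) (fun _ => 1 - τ) (fun _ => 1 - τ - 1 / b) 1,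
      isRel_extend ?_ ?_, by simp [extend], ?_⟩
    · simp only [Finset.sum_const, Finset.card_univ, Fintype.card_fin, nsmul_eq_mul]
      linarith
    · simp only [Finset.sum_const, Finset.card_univ, Fintype.card_fin, nsmul_eq_mul]
      rw [mul_sub _ _ (1 / (b : ℝ)), mul_div_cancel₀ _ (by linarith)]
      ring
    · have hb0 : (0 : ℝ) < 1 / b := by positivity
      rintro (i | j | _ | _ | j | ⟨j, i⟩) hi
      · simp only [extend]; linarith
      · simp only [extend]; linarith
      · simp only [extend]; linarith
      · exact absurd rfl hi
      · simp only [extend]; linarith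
      · exact extend_w_lt_one (fun j => by linarith) (fun j => by linarith) j i
  · refine ⟨extend α (fun _ => (2 * τ - 2) / a) (fun _ => (1 - τ) / b)
      (fun j => if j = j₀ then 1 else 0) (-τ), isRel_extend ?_ ?_, by simp [extend], ?_⟩
    · simp only [Finset.sum_const, Finset.card_univ, Fintype.card_fin, nsmul_eq_mul]
      rw [mul_div_cancel₀ _ (by linarith), mul_div_cancel₀ _ (by linarith)]
      linarith
    · simp only [Finset.sum_const, Finset.card_univ, Fintype.card_fin, nsmul_eq_mul,
        Finset.sum_ite_eq', Finset.mem_univ, if_true]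
      rw [mul_div_cancel₀ _ (by linarith)]
      ring
    · rintro (i | j | _ | _ | j | ⟨j, i⟩) hi
      · exact hdiv' _ (by linarith)
      · exact hdiv _ (by linarith)
      · simp only [extend]; linarith
      · simp only [extend]; linarith
      · have : j ≠ j₀ := fun h => hi (h ▸ rfl)
        simp [extend, this]
      · exact extend_w_lt_one (fun j => (hdiv _ (by linarith)).le)
          (fun j => by split_ifs <;> norm_num) j i
  · have hlR : (1 : ℝ) ≤ l j₀ := by exact_mod_cast hl j₀
    let g : Idx a b k l → ℝ
      | .w j i => if j = j₀ then if (i : ℕ) = i₀ then 1 else -1 / l j₀ else 0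
      | _ => 0
    have hw : ∀ i : Fin (l j₀ + 1), g (.w j₀ i) = (if i = i₀ then 1 else -1 / (l j₀ : ℝ) : ℝ) := by
      intro i
      simp [g, Fin.ext_iff]
    refine ⟨g, ⟨by simp [g], by simp [g], by simp [g], fun j => ?_⟩, by simp [g], ?_⟩
    · have h0 : ∀ s : Fin b ⊕ Fin b, g (.ofSum s) = 0 := by
        rintro (s | s) <;> rfl
      simp only [h0, Finset.sum_const_zero]
      by_cases hj : j = j₀
      · subst hj
        simp only [hw]
        rw [← Finset.sum_erase_add _ _ (Finset.mem_univ i₀), Finset.sum_congr rfl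
          (g := fun _ => (-1 / l j : ℝ)) fun i hi => if_neg (Finset.ne_of_mem_erase hi)]
        simp only [Finset.sum_const, Finset.card_erase_of_mem (Finset.mem_univ _),
          Finset.card_univ, Fintype.card_fin, nsmul_eq_mul, Nat.add_sub_cancel, if_true]
        rw [mul_div_cancel₀ _ (by linarith)]
        norm_num
      · simp [g, hj]
    · rintro (i | j | _ | _ | j | ⟨j, i⟩) hi
      · exact zero_lt_one
      · exact zero_lt_one
      · exact zero_lt_one
      · exact zero_lt_one
      · exact zero_lt_one
      · by_cases hj : j = j₀
        · subst hj
          have : i ≠ i₀ := fun h => hi (h ▸ rfl)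
          rw [hw, if_neg this]
          have : (-1 : ℝ) / l j < 0 := div_neg_of_neg_of_pos (by norm_num) (by linarith)
          linarith
        · simp [g, hj]

theorem vec_injective (ha : 2 ≤ a) (hb : 1 ≤ b) (hl : ∀ j, 1 ≤ l j) :
    Function.Injective (vec a b k l α) := by
  intro i i' h
  by_contra hne
  obtain ⟨g, hg, hi, hlt⟩ := exists_isRel_lt (α := α) ha hb hl i
  obtain ⟨φ, hφ⟩ := exists_dual ha hb hg
  have h1 := hlt i' (Ne.symm hne)
  rw [← hφ, ← h, hφ, hi] at h1
  exact lt_irrefl _ h1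

theorem vec_mem_vertexSet (ha : 2 ≤ a) (hb : 1 ≤ b) (hl : ∀ j, 1 ≤ l j) (i : Idx a b k l) :
    vec a b k l α i ∈ vertexSet (P a b k l α) := by
  obtain ⟨g, hg, hi, hlt⟩ := exists_isRel_lt (α := α) ha hb hl i
  obtain ⟨φ, hφ⟩ := exists_dual ha hb hg
  rw [P_eq]
  by_contra hmem
  have hsub : convexHull ℝ (vertexSet (convexHull ℝ (Set.range (vec a b k l α)))) ⊆
      {q | φ q < 1} := by
    refine convexHull_min (fun q hq => ?_) (convex_halfSpace_lt φ.isLinear 1)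
    obtain ⟨i', rfl⟩ := extremePoints_convexHull_subset hq
    have hne : i' ≠ i := by rintro rfl; exact hmem hq
    exact (hφ i').trans_lt (hlt i' hne)
  rw [SmoothFano.convexHull_vertexSet (Set.finite_range _)] at hsub
  have h1 : φ (vec a b k l α i) < 1 := hsub (subset_convexHull ℝ _ ⟨i, rfl⟩)
  rw [hφ, hi] at h1
  exact lt_irrefl _ h1

end Vertices

end PG

/-- For `a ≥ 2`, `b ≥ 1`, `k ≥ 1`, `l_1, …, l_k ≥ 1`, any
assignment `α` as in the construction, and `n = a + 2b - 1 + ∑ l_j`, there is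
no smooth Fano `n`-polytope `R` with `n + k + 4` vertices such that
`V(P(a, b, k, l, α)) ⊆ V(R)`. -/
theorem no_smooth_Fano_superpolytope_of_PG (a b k : ℕ) (l : Fin k → ℕ)
    (ha : 2 ≤ a) (hb : 1 ≤ b) (hk : 1 ≤ k) (hl : ∀ j, 1 ≤ l j)
    (α : (j : Fin k) → Fin (l j) → (Fin b ⊕ Fin b))
    (hα : ∀ s : Fin b ⊕ Fin b, ∃ j i, α j i = s) :
    ¬ ∃ R : Set (Fin (PG.dim a b k l) → ℝ), IsSmoothFano R ∧
      (vertexSet R).ncard = PG.dim a b k l + k + 4 ∧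
      vertexSet (PG.P a b k l α) ⊆ vertexSet R := by
  rintro ⟨R, hR, hcard, hsub⟩
  have hV : Set.range (PG.vec a b k l α) ⊆ vertexSet R := by
    rintro _ ⟨i, rfl⟩
    exact hsub (PG.vec_mem_vertexSet ha hb hl i)
  have hrange : (Set.range (PG.vec a b k l α)).ncard = PG.dim a b k l + k + 3 := by
    rw [← Set.image_univ, Set.ncard_image_of_injective _ (PG.vec_injective ha hb hl),
      Set.ncard_univ, Nat.card_eq_fintype_card, PG.Idx.card_eq]
    unfold PG.dim
    omega
  obtain ⟨x, hx, hVR⟩ := (Set.exists_eq_insert_iff_ncard (Set.finite_range _)).2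
    ⟨hV, by rw [hrange, hcard]⟩
  exact PG.vertexSet_ne_insert ha hb hR hx hVR.symm
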